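/- arXiv:math/9406224 — 2 statements merged into one kernel-verified Lean document; each statement's English description precedes it below -/
import Mathlib

section
/- Let (α_n) and (β_n) be sequences with α_n, β_n > −1 such that α_n/n → ∞ and β_n/n → b for some b ≥ 0 as n → ∞. Set s_1 = 2(2+b) − 4√(1+b) and s_2 = 2(2+b) + 4√(1+b). Then for every ξ with s_1 ≤ ξ ≤ s_2, lim_{n→∞} (1/n)·N^{(α_n,β_n)}((n/α_n)·ξ − 1) = (1/(4π)) · ∫_{s_1}^{ξ} √((s_2−x)(x−s_1))/x dx. -/
open Filter Topology

/-- Generalized binomial coefficient C(t, m) = t(t-1)⋯(t-m+1)/m! for real t. -/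
noncomputable def genBinom (t : ℝ) (m : ℕ) : ℝ :=
  (∏ i ∈ Finset.range m, (t - (i : ℝ))) / (Nat.factorial m)

/-- Jacobi polynomial P_n^{(α,β)}. -/
noncomputable def jacobiP (n : ℕ) (α β : ℝ) (x : ℝ) : ℝ :=
  ∑ k ∈ Finset.range (n + 1),
    genBinom ((n : ℝ) + α) (n - k) * genBinom ((n : ℝ) + β) k *
      ((x - 1) / 2) ^ k * ((x + 1) / 2) ^ (n - k)

/-- Number of zeros of P_n^{(α,β)} that are ≤ ξ. -/
noncomputable def jacobiN (n : ℕ) (α β ξ : ℝ) : ℕ :=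
  {x : ℝ | jacobiP n α β x = 0 ∧ x ≤ ξ}.ncard

/-! ### Sturm comparison with a constant coefficient -/

section Sturm

variable {u u₁ Q : ℝ → ℝ} {a b ω : ℝ}

/-- A solution of `u'' + Q u = 0` with `Q ≥ ω ^ 2` cannot stay positive on `(a, a + π / ω]`. -/
lemma sturm_not_forall_pos (hω : 0 < ω)
    (hu : ∀ x ∈ Set.Icc a (a + Real.pi / ω), HasDerivAt u (u₁ x) x)
    (hu₁ : ∀ x ∈ Set.Icc a (a + Real.pi / ω), HasDerivAt u₁ (-(Q x * u x)) x)
    (hQ : ∀ x ∈ Set.Icc a (a + Real.pi / ω), ω ^ 2 ≤ Q x) :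
    ¬ ∀ x ∈ Set.Ioc a (a + Real.pi / ω), 0 < u x := by
  intro hpos
  have hL : 0 < Real.pi / ω := div_pos Real.pi_pos hω
  set W : ℝ → ℝ := fun x =>
    u₁ x * Real.sin (ω * (x - a)) - u x * (ω * Real.cos (ω * (x - a))) with hW
  have hlin : ∀ x : ℝ, HasDerivAt (fun x => ω * (x - a)) ω x := fun x => by
    simpa using ((hasDerivAt_id x).sub_const a).const_mul ω
  have hder : ∀ x ∈ Set.Icc a (a + Real.pi / ω),
      HasDerivAt W ((ω ^ 2 - Q x) * (u x * Real.sin (ω * (x - a)))) x := by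
    intro x hx
    have h := ((hu₁ x hx).mul (hlin x).sin).sub ((hu x hx).mul ((hlin x).cos.const_mul ω))
    refine HasDerivAt.congr_deriv h ?_
    ring
  have hanti : AntitoneOn W (Set.Icc a (a + Real.pi / ω)) := by
    refine antitoneOn_of_hasDerivWithinAt_nonpos (convex_Icc _ _)
      (fun x hx => (hder x hx).continuousAt.continuousWithinAt)
      (fun x hx => (hder x (interior_subset hx)).hasDerivWithinAt) ?_
    intro x hx
    rw [interior_Icc] at hx
    have hx' := Set.Ioo_subset_Icc_self hx
    refine mul_nonpos_of_nonpos_of_nonneg (by linarith [hQ x hx'])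
      (mul_nonneg (hpos x (Set.Ioo_subset_Ioc_self hx)).le ?_)
    refine Real.sin_nonneg_of_nonneg_of_le_pi
      (mul_nonneg hω.le (by linarith [hx.1])) ?_
    have : x - a ≤ Real.pi / ω := by linarith [hx.2]
    rwa [le_div_iff₀ hω, mul_comm] at this
  have hle := hanti (Set.left_mem_Icc.2 (by linarith)) (Set.right_mem_Icc.2 (by linarith))
    (by linarith : a ≤ a + Real.pi / ω)
  have hend := hpos (a + Real.pi / ω) ⟨by linarith, le_rfl⟩
  have hua : 0 ≤ u a := by
    have hc : Tendsto u (𝓝[>] a) (𝓝 (u a)) :=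
      (hu a ⟨le_rfl, by linarith⟩).continuousAt.continuousWithinAt.tendsto
    refine ge_of_tendsto hc ?_
    filter_upwards [Ioc_mem_nhdsGT (by linarith : a < a + Real.pi / ω)] with x hx
    exact (hpos x hx).le
  have e : ω * (a + Real.pi / ω - a) = Real.pi := by field_simp; ring
  simp only [hW, e] at hle
  simp at hle
  nlinarith

/-- Sturm comparison: a solution of `u'' + Q u = 0` with `Q ≥ ω ^ 2` has a zero in
`(a, a + π / ω]`. -/
lemma sturm_exists_zero (hω : 0 < ω)
    (hu : ∀ x ∈ Set.Icc a (a + Real.pi / ω), HasDerivAt u (u₁ x) x)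
    (hu₁ : ∀ x ∈ Set.Icc a (a + Real.pi / ω), HasDerivAt u₁ (-(Q x * u x)) x)
    (hQ : ∀ x ∈ Set.Icc a (a + Real.pi / ω), ω ^ 2 ≤ Q x) :
    ∃ x ∈ Set.Ioc a (a + Real.pi / ω), u x = 0 := by
  by_contra! hne
  have hL : 0 < Real.pi / ω := div_pos Real.pi_pos hω
  have hcont : ∀ x ∈ Set.Ioc a (a + Real.pi / ω),
      ContinuousOn u (Set.Icc x (a + Real.pi / ω)) := fun x hx y hy =>
    (hu y ⟨hx.1.le.trans hy.1, hy.2⟩).continuousAt.continuousWithinAt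
  rcases lt_or_gt_of_ne (hne (a + Real.pi / ω) ⟨by linarith, le_rfl⟩) with hneg | hpos
  · refine sturm_not_forall_pos (u := fun x => -u x) (u₁ := fun x => -u₁ x) (Q := Q) hω
      (fun x hx => (hu x hx).neg) (fun x hx => ?_) hQ fun x hx => ?_
    · refine HasDerivAt.congr_deriv (hu₁ x hx).neg ?_
      ring
    · by_contra! h
      obtain ⟨z, hz, hz0⟩ := intermediate_value_Icc' hx.2 (hcont x hx)
        (⟨hneg.le, by linarith⟩ : (0 : ℝ) ∈ Set.Icc _ _)
      exact hne z ⟨hx.1.trans_le hz.1, hz.2⟩ hz0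
  · refine sturm_not_forall_pos hω hu hu₁ hQ fun x hx => ?_
    by_contra! h
    obtain ⟨z, hz, hz0⟩ := intermediate_value_Icc hx.2 (hcont x hx)
      (⟨h, hpos.le⟩ : (0 : ℝ) ∈ Set.Icc _ _)
    exact hne z ⟨hx.1.trans_le hz.1, hz.2⟩ hz0

/-- Sturm comparison, counting form. -/
lemma sturm_le_ncard_zeros (hω : 0 < ω)
    (hu : ∀ x ∈ Set.Icc a b, HasDerivAt u (u₁ x) x)
    (hu₁ : ∀ x ∈ Set.Icc a b, HasDerivAt u₁ (-(Q x * u x)) x)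
    (hQ : ∀ x ∈ Set.Icc a b, ω ^ 2 ≤ Q x)
    (hfin : {x | u x = 0 ∧ x ∈ Set.Ioc a b}.Finite)
    (m : ℕ) (hm : a + m * (Real.pi / ω) ≤ b) :
    m ≤ {x | u x = 0 ∧ x ∈ Set.Ioc a b}.ncard := by
  have hL : 0 < Real.pi / ω := div_pos Real.pi_pos hω
  suffices h : ∀ j : ℕ, a + j * (Real.pi / ω) ≤ b →
      j ≤ {x | u x = 0 ∧ x ∈ Set.Ioc a (a + j * (Real.pi / ω))}.ncard from
    (h m hm).trans (Set.ncard_le_ncard (fun x hx => ⟨hx.1, hx.2.1, hx.2.2.trans hm⟩) hfin)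
  intro j
  induction j with
  | zero => simp
  | succ j ih =>
    intro hj
    push_cast at hj ⊢
    have hj0 : (0 : ℝ) ≤ j * (Real.pi / ω) := by positivity
    have hsub : ∀ x ∈ Set.Icc (a + j * (Real.pi / ω)) (a + j * (Real.pi / ω) + Real.pi / ω),
        x ∈ Set.Icc a b := fun x hx => ⟨by linarith [hx.1], by linarith [hx.2]⟩
    obtain ⟨z, hz, hz0⟩ := sturm_exists_zero (a := a + j * (Real.pi / ω)) hω
      (fun x hx => hu x (hsub x hx)) (fun x hx => hu₁ x (hsub x hx))
      (fun x hx => hQ x (hsub x hx))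
    have hfin' : {x | u x = 0 ∧ x ∈ Set.Ioc a (a + j * (Real.pi / ω))}.Finite :=
      hfin.subset fun x hx => ⟨hx.1, hx.2.1, by linarith [hx.2.2]⟩
    have hz' : z ∉ {x | u x = 0 ∧ x ∈ Set.Ioc a (a + j * (Real.pi / ω))} :=
      fun h => absurd hz.1 (not_lt.2 h.2.2)
    calc j + 1 ≤ {x | u x = 0 ∧ x ∈ Set.Ioc a (a + j * (Real.pi / ω))}.ncard + 1 :=
          Nat.succ_le_succ (ih (by linarith))
      _ = (insert z {x | u x = 0 ∧ x ∈ Set.Ioc a (a + j * (Real.pi / ω))}).ncard :=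
          (Set.ncard_insert_of_notMem hz' hfin').symm
      _ ≤ _ := by
          refine Set.ncard_le_ncard (Set.insert_subset ⟨hz0, ?_, ?_⟩ ?_)
            (hfin.subset fun x hx => ⟨hx.1, hx.2.1, hx.2.2.trans hj⟩)
          · linarith [hz.1]
          · linarith [hz.2]
          · exact fun x hx => ⟨hx.1, hx.2.1, by linarith [hx.2.2]⟩

end Sturm

/-! ### The differential equation of the Jacobi polynomials -/

section Jacobi

variable (n : ℕ) (α β : ℝ)

lemma genBinom_succ_mul (t : ℝ) (m : ℕ) :
    genBinom t (m + 1) * (m + 1) = genBinom t m * (t - m) := by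
  have h : (Nat.factorial m : ℝ) ≠ 0 := by positivity
  have h' : (m : ℝ) + 1 ≠ 0 := by positivity
  simp only [genBinom, Finset.prod_range_succ, Nat.factorial_succ]
  push_cast
  field_simp

/-- The `k`-th summand of `jacobiP`. -/
noncomputable def jacobiTerm (k : ℕ) (x : ℝ) : ℝ :=
  genBinom ((n : ℝ) + α) (n - k) * genBinom ((n : ℝ) + β) k *
    ((x - 1) / 2) ^ k * ((x + 1) / 2) ^ (n - k)

/-- The logarithmic derivative of `jacobiTerm`. -/
noncomputable def jacobiTermLogDeriv (k : ℕ) (x : ℝ) : ℝ :=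
  k / (x - 1) + ((n - k : ℕ) : ℝ) / (x + 1)

/-- The derivative of `jacobiP` away from `±1`. -/
noncomputable def jacobiP₁ (x : ℝ) : ℝ :=
  ∑ k ∈ Finset.range (n + 1), jacobiTerm n α β k x * jacobiTermLogDeriv n k x

/-- The second derivative of `jacobiP` away from `±1`. -/
noncomputable def jacobiP₂ (x : ℝ) : ℝ :=
  ∑ k ∈ Finset.range (n + 1), jacobiTerm n α β k x *
    (jacobiTermLogDeriv n k x ^ 2 - k / (x - 1) ^ 2 - ((n - k : ℕ) : ℝ) / (x + 1) ^ 2)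

variable {n α β} {x : ℝ}

lemma hasDerivAt_half_pow (c : ℝ) (k : ℕ) (h : x + c ≠ 0) :
    HasDerivAt (fun x : ℝ => ((x + c) / 2) ^ k) (((x + c) / 2) ^ k * (k / (x + c))) x := by
  have h1 := (((hasDerivAt_id x).add_const c).div_const 2).pow k
  refine HasDerivAt.congr_deriv h1 ?_
  rcases k with _ | k
  · simp
  · simp only [id, pow_succ, Nat.add_sub_cancel]
    field_simp

lemma hasDerivAt_jacobiTerm (k : ℕ) (h₁ : x - 1 ≠ 0) (h₂ : x + 1 ≠ 0) :
    HasDerivAt (jacobiTerm n α β k) (jacobiTerm n α β k x * jacobiTermLogDeriv n k x) x := by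
  have hl := hasDerivAt_half_pow (x := x) (-1) k (by simpa [sub_eq_add_neg] using h₁)
  have h := (hl.const_mul (genBinom ((n : ℝ) + α) (n - k) * genBinom ((n : ℝ) + β) k)).mul
    (hasDerivAt_half_pow 1 (n - k) h₂)
  simp only [← sub_eq_add_neg] at h
  refine HasDerivAt.congr_deriv h ?_
  simp only [jacobiTerm, jacobiTermLogDeriv]
  ring

lemma hasDerivAt_jacobiTermLogDeriv (k : ℕ) (h₁ : x - 1 ≠ 0) (h₂ : x + 1 ≠ 0) :
    HasDerivAt (jacobiTermLogDeriv n k)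
      (-(k / (x - 1) ^ 2) - ((n - k : ℕ) : ℝ) / (x + 1) ^ 2) x := by
  have h := ((hasDerivAt_const x (k : ℝ)).div ((hasDerivAt_id x).sub_const 1) h₁).add
    ((hasDerivAt_const x ((n - k : ℕ) : ℝ)).div ((hasDerivAt_id x).add_const 1) h₂)
  refine HasDerivAt.congr_deriv h ?_
  simp only [id]
  ring

lemma hasDerivAt_jacobiP (h₁ : x - 1 ≠ 0) (h₂ : x + 1 ≠ 0) :
    HasDerivAt (jacobiP n α β) (jacobiP₁ n α β x) x :=
  HasDerivAt.fun_sum fun k _ => hasDerivAt_jacobiTerm k h₁ h₂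

lemma hasDerivAt_jacobiP₁ (h₁ : x - 1 ≠ 0) (h₂ : x + 1 ≠ 0) :
    HasDerivAt (jacobiP₁ n α β) (jacobiP₂ n α β x) x := by
  refine HasDerivAt.fun_sum fun k _ => ?_
  refine HasDerivAt.congr_deriv ((hasDerivAt_jacobiTerm k h₁ h₂).mul
    (hasDerivAt_jacobiTermLogDeriv k h₁ h₂)) ?_
  ring

lemma jacobiTerm_succ {k : ℕ} (hk : k < n) (h₁ : x - 1 ≠ 0) (h₂ : x + 1 ≠ 0) :
    jacobiTerm n α β (k + 1) x * ((k + 1) * (k + 1 + α) / (x - 1)) =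
      jacobiTerm n α β k x * ((n - k) * (n - k + β) / (x + 1)) := by
  obtain ⟨m, rfl⟩ : ∃ m, n = k + 1 + m := ⟨n - (k + 1), by omega⟩
  have e₁ : k + 1 + m - k = m + 1 := by omega
  have e₂ : k + 1 + m - (k + 1) = m := by omega
  have hα := genBinom_succ_mul (((k + 1 + m : ℕ) : ℝ) + α) m
  have hβ := genBinom_succ_mul (((k + 1 + m : ℕ) : ℝ) + β) k
  simp only [jacobiTerm, e₁, e₂, pow_succ]
  set A := genBinom (((k + 1 + m : ℕ) : ℝ) + α) m
  set A' := genBinom (((k + 1 + m : ℕ) : ℝ) + α) (m + 1)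
  set B := genBinom (((k + 1 + m : ℕ) : ℝ) + β) k
  set B' := genBinom (((k + 1 + m : ℕ) : ℝ) + β) (k + 1)
  push_cast at hα hβ ⊢
  have key : A * B' * ((k + 1) * (k + 1 + α)) = A' * B * ((m + 1) * (m + 1 + β)) := by
    linear_combination (A * (k + 1 + α)) * hβ - (B * (m + 1 + β)) * hα
  have h : A * B' * ((x - 1) / 2) ^ k * ((x + 1) / 2) ^ m * ((k + 1) * (k + 1 + α)) =
      A' * B * ((x - 1) / 2) ^ k * ((x + 1) / 2) ^ m * ((m + 1) * (m + 1 + β)) := by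
    linear_combination (((x - 1) / 2) ^ k * ((x + 1) / 2) ^ m) * key
  calc _ = A * B' * ((x - 1) / 2) ^ k * ((x + 1) / 2) ^ m * ((k + 1) * (k + 1 + α)) / 2 := by
        generalize ((x + 1) / 2) ^ m = v
        generalize ((x - 1) / 2) ^ k = w
        field_simp
    _ = _ := by
        rw [h]
        generalize ((x + 1) / 2) ^ m = v
        generalize ((x - 1) / 2) ^ k = w
        field_simp
        ring

/-- Jacobi's differential equation. -/
lemma jacobiP_ode (h₁ : x - 1 ≠ 0) (h₂ : x + 1 ≠ 0) :
    (1 - x ^ 2) * jacobiP₂ n α β x + (β - α - (α + β + 2) * x) * jacobiP₁ n α β x +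
      n * (n + α + β + 1) * jacobiP n α β x = 0 := by
  have hterm : ∀ k ∈ Finset.range (n + 1),
      (1 - x ^ 2) * (jacobiTerm n α β k x *
        (jacobiTermLogDeriv n k x ^ 2 - k / (x - 1) ^ 2 - ((n - k : ℕ) : ℝ) / (x + 1) ^ 2)) +
      (β - α - (α + β + 2) * x) * (jacobiTerm n α β k x * jacobiTermLogDeriv n k x) +
      n * (n + α + β + 1) * jacobiTerm n α β k x =
      2 * (jacobiTerm n α β k x * ((n - k) * (n - k + β) / (x + 1))) -
      2 * (jacobiTerm n α β k x * (k * (k + α) / (x - 1))) := by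
    intro k hk
    have hk' : k ≤ n := Nat.lt_succ_iff.1 (Finset.mem_range.1 hk)
    simp only [jacobiTermLogDeriv, Nat.cast_sub hk']
    field_simp
    ring
  have hP : jacobiP n α β x = ∑ k ∈ Finset.range (n + 1), jacobiTerm n α β k x := rfl
  rw [hP, jacobiP₁, jacobiP₂, Finset.mul_sum, Finset.mul_sum, Finset.mul_sum,
    ← Finset.sum_add_distrib, ← Finset.sum_add_distrib, Finset.sum_congr rfl hterm,
    Finset.sum_sub_distrib, Finset.sum_range_succ, Finset.sum_range_succ']
  simp only [sub_self, zero_mul, zero_div, mul_zero, add_zero, Nat.cast_zero, sub_eq_zero]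
  refine Finset.sum_congr rfl fun k hk => ?_
  rw [← jacobiTerm_succ (Finset.mem_range.1 hk) h₁ h₂]
  push_cast
  ring

lemma exists_polynomial_jacobiP (n : ℕ) (α β : ℝ) :
    ∃ p : Polynomial ℝ, p.natDegree ≤ n ∧ ∀ x, p.eval x = jacobiP n α β x := by
  refine ⟨∑ k ∈ Finset.range (n + 1),
    Polynomial.C (genBinom ((n : ℝ) + α) (n - k) * genBinom ((n : ℝ) + β) k) *
      (Polynomial.C (1 / 2) * Polynomial.X + Polynomial.C (-1 / 2)) ^ k *
      (Polynomial.C (1 / 2) * Polynomial.X + Polynomial.C (1 / 2)) ^ (n - k), ?_, fun x => ?_⟩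
  · refine Polynomial.natDegree_sum_le_of_forall_le _ _ fun k hk => ?_
    have hk' : k ≤ n := Nat.lt_succ_iff.1 (Finset.mem_range.1 hk)
    have h : ∀ c : ℝ, ∀ j : ℕ,
        ((Polynomial.C (1 / 2) * Polynomial.X + Polynomial.C c) ^ j).natDegree ≤ j := fun c j =>
      (Polynomial.natDegree_pow_le_of_le j Polynomial.natDegree_linear_le).trans (by simp)
    refine Polynomial.natDegree_mul_le.trans ?_
    have h1 := (Polynomial.natDegree_C_mul_le
      (genBinom ((n : ℝ) + α) (n - k) * genBinom ((n : ℝ) + β) k)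
      ((Polynomial.C (1 / 2 : ℝ) * Polynomial.X + Polynomial.C (-1 / 2)) ^ k)).trans (h _ k)
    have h2 := h (1 / 2) (n - k)
    omega
  · rw [Polynomial.eval_finsetSum, jacobiP]
    refine Finset.sum_congr rfl fun k _ => ?_
    simp
    congr 2 <;> ring

lemma jacobiP_one_pos (hα : -1 < α) : 0 < jacobiP n α β 1 := by
  have h : jacobiP n α β 1 = genBinom ((n : ℝ) + α) n := by
    rw [jacobiP, Finset.sum_range_succ', Finset.sum_eq_zero]
    · simp [genBinom]
    · simp
  rw [h, genBinom]
  refine div_pos (Finset.prod_pos fun i hi => ?_) (by positivity)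
  have : (i : ℝ) + 1 ≤ n := by exact_mod_cast Finset.mem_range.1 hi
  linarith

lemma jacobiP_zeros_finite (hα : -1 < α) :
    {x | jacobiP n α β x = 0}.Finite ∧ {x | jacobiP n α β x = 0}.ncard ≤ n := by
  obtain ⟨p, hdeg, hp⟩ := exists_polynomial_jacobiP n α β
  have hp0 : p ≠ 0 := by
    rintro rfl
    have := jacobiP_one_pos (n := n) (β := β) hα
    simp [← hp] at this
  have hset : {x | jacobiP n α β x = 0} = ↑p.roots.toFinset := by
    ext x
    simp [hp0, hp]
  rw [hset]
  refine ⟨Finset.finite_toSet _, ?_⟩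
  rw [Set.ncard_coe_finset]
  exact (Multiset.toFinset_card_le _).trans ((Polynomial.card_roots' p).trans hdeg)

variable (n α β) in
/-- The potential in the normal form `u'' + Q u = 0` of Jacobi's equation. -/
noncomputable def jacobiPotential (x : ℝ) : ℝ :=
  (1 - α ^ 2) / (4 * (1 - x) ^ 2) + (1 - β ^ 2) / (4 * (1 + x) ^ 2) +
    (n * (n + α + β + 1) + (α + 1) * (β + 1) / 2) / (1 - x ^ 2)

lemma le_ncard_jacobiP_zeros {a b ω : ℝ} (hα : -1 < α) (hω : 0 < ω) (ha : -1 < a) (hb : b < 1)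
    (hQ : ∀ x ∈ Set.Icc a b, ω ^ 2 ≤ jacobiPotential n α β x)
    (m : ℕ) (hm : a + m * (Real.pi / ω) ≤ b) :
    m ≤ {x | jacobiP n α β x = 0 ∧ x ∈ Set.Ioc a b}.ncard := by
  set r : ℝ → ℝ := fun x =>
    Real.exp ((β + 1) / 2 * Real.log (1 + x) + (α + 1) / 2 * Real.log (1 - x)) with hr
  set ρ : ℝ → ℝ := fun x => (β + 1) / 2 / (1 + x) - (α + 1) / 2 / (1 - x) with hρ
  have hr0 : ∀ x, r x ≠ 0 := fun x => (Real.exp_pos _).ne'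
  have hne : ∀ x ∈ Set.Icc a b, x - 1 ≠ 0 ∧ x + 1 ≠ 0 ∧ 1 + x ≠ 0 ∧ 1 - x ≠ 0 := by
    intro x hx
    have h1 : -1 < x := by linarith [hx.1]
    have h2 : x < 1 := by linarith [hx.2]
    refine ⟨?_, ?_, ?_, ?_⟩ <;> intro h <;> linarith
  have hr' : ∀ x ∈ Set.Icc a b, HasDerivAt r (r x * ρ x) x := by
    intro x hx
    obtain ⟨-, -, h3, h4⟩ := hne x hx
    have h := (((((hasDerivAt_id x).const_add 1).log h3).const_mul ((β + 1) / 2)).add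
      ((((hasDerivAt_id x).const_sub 1).log h4).const_mul ((α + 1) / 2))).exp
    refine HasDerivAt.congr_deriv h ?_
    simp only [hr, hρ, id, Pi.add_apply]
    ring
  have hρ' : ∀ x ∈ Set.Icc a b,
      HasDerivAt ρ (-((β + 1) / 2 / (1 + x) ^ 2) - (α + 1) / 2 / (1 - x) ^ 2) x := by
    intro x hx
    obtain ⟨-, -, h3, h4⟩ := hne x hx
    have h := ((hasDerivAt_const x ((β + 1) / 2)).div ((hasDerivAt_id x).const_add 1) h3).sub
      ((hasDerivAt_const x ((α + 1) / 2)).div ((hasDerivAt_id x).const_sub 1) h4)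
    refine HasDerivAt.congr_deriv h ?_
    simp only [id]
    ring
  have hset : {x | jacobiP n α β x = 0 ∧ x ∈ Set.Ioc a b} =
      {x | r x * jacobiP n α β x = 0 ∧ x ∈ Set.Ioc a b} := by
    ext x
    simp [hr0]
  have hfin : {x | jacobiP n α β x = 0 ∧ x ∈ Set.Ioc a b}.Finite :=
    (jacobiP_zeros_finite hα).1.subset fun x hx => hx.1
  rw [hset] at hfin ⊢
  refine sturm_le_ncard_zeros (Q := jacobiPotential n α β)
    (u₁ := fun x => r x * (ρ x * jacobiP n α β x + jacobiP₁ n α β x))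
    hω (fun x hx => ?_) (fun x hx => ?_) hQ hfin m hm
  · obtain ⟨h1, h2, -, -⟩ := hne x hx
    refine HasDerivAt.congr_deriv
      ((hr' x hx).mul (hasDerivAt_jacobiP (n := n) (α := α) (β := β) h1 h2)) ?_
    ring
  · obtain ⟨h1, h2, h3, h4⟩ := hne x hx
    have h := (hr' x hx).mul (((hρ' x hx).mul (hasDerivAt_jacobiP (n := n) (α := α) (β := β)
      h1 h2)).add (hasDerivAt_jacobiP₁ (n := n) (α := α) (β := β) h1 h2))
    refine HasDerivAt.congr_deriv h ?_
    have ode := jacobiP_ode (n := n) (α := α) (β := β) h1 h2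
    have h5 : (1 - x ^ 2 : ℝ) ≠ 0 := by
      rw [show (1 - x ^ 2 : ℝ) = (1 - x) * (1 + x) by ring]
      exact mul_ne_zero h4 h3
    have hP₂ : jacobiP₂ n α β x = -((β - α - (α + β + 2) * x) * jacobiP₁ n α β x +
        n * (n + α + β + 1) * jacobiP n α β x) / ((1 - x) * (1 + x)) := by
      field_simp
      linear_combination ode
    simp only [hP₂, jacobiPotential, hρ, Pi.add_apply, Pi.mul_apply]
    rw [show (1 - x ^ 2 : ℝ) = (1 - x) * (1 + x) by ring]
    field_simp
    ring

end Jacobi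

/-! ### The limiting distribution -/

section Primitive

/-- An explicit primitive of `√((s₂ - x) (x - s₁)) / x`. -/
noncomputable def densityPrimitive (s₁ s₂ x : ℝ) : ℝ :=
  √((s₂ - x) * (x - s₁)) + (s₁ + s₂) / 2 * Real.arcsin ((2 * x - s₁ - s₂) / (s₂ - s₁)) -
    √(s₁ * s₂) * Real.arcsin (((s₁ + s₂) * x - 2 * (s₁ * s₂)) / (x * (s₂ - s₁)))

lemma hasDerivAt_arcsin_comp {f : ℝ → ℝ} {f' x w : ℝ} (hf : HasDerivAt f f' x) (hw : 0 < w)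
    (h : 1 - f x ^ 2 = w ^ 2) : HasDerivAt (fun x => Real.arcsin (f x)) (f' / w) x := by
  have hw2 : 0 < w ^ 2 := by positivity
  have h1 : f x ≠ -1 := fun e => by rw [e] at h; linarith
  have h2 : f x ≠ 1 := fun e => by rw [e] at h; linarith
  refine HasDerivAt.congr_deriv ((Real.hasDerivAt_arcsin h1 h2).comp x hf) ?_
  rw [h, Real.sqrt_sq hw.le]
  ring

variable {s₁ s₂ : ℝ}

lemma hasDerivAt_densityPrimitive (h₀ : 0 ≤ s₁) {x : ℝ} (hx : x ∈ Set.Ioo s₁ s₂) :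
    HasDerivAt (densityPrimitive s₁ s₂) (√((s₂ - x) * (x - s₁)) / x) x := by
  obtain ⟨hx1, hx2⟩ := hx
  have hx0 : 0 < x := h₀.trans_lt hx1
  have hD : 0 < s₂ - s₁ := by linarith
  have hpos : 0 < (s₂ - x) * (x - s₁) := mul_pos (by linarith) (by linarith)
  set R := √((s₂ - x) * (x - s₁)) with hR
  have hR0 : 0 < R := Real.sqrt_pos.2 hpos
  have hR2 : R ^ 2 = (s₂ - x) * (x - s₁) := Real.sq_sqrt hpos.le
  have hd1 : HasDerivAt (fun x => √((s₂ - x) * (x - s₁))) ((s₁ + s₂ - 2 * x) / (2 * R)) x := by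
    have h := (((hasDerivAt_id x).const_sub s₂).mul ((hasDerivAt_id x).sub_const s₁)).sqrt
      hpos.ne'
    refine HasDerivAt.congr_deriv h ?_
    simp only [id, Pi.mul_apply, ← hR]
    ring
  have hd2 : HasDerivAt (fun x => Real.arcsin ((2 * x - s₁ - s₂) / (s₂ - s₁)))
      (2 / (s₂ - s₁) / (2 * R / (s₂ - s₁))) x := by
    refine hasDerivAt_arcsin_comp (f := fun x => (2 * x - s₁ - s₂) / (s₂ - s₁)) ?_
      (by positivity) ?_
    · refine HasDerivAt.congr_deriv (((((hasDerivAt_id x).const_mul 2).sub_const s₁).sub_const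
        s₂).div_const (s₂ - s₁)) ?_
      ring
    · rw [div_pow, div_pow, mul_pow, hR2]
      field_simp
      ring
  have hd3 : HasDerivAt (fun x => √(s₁ * s₂) *
      Real.arcsin (((s₁ + s₂) * x - 2 * (s₁ * s₂)) / (x * (s₂ - s₁)))) (s₁ * s₂ / (x * R)) x := by
    rcases h₀.eq_or_lt with h0 | h0
    · subst h0
      simpa using hasDerivAt_const x (0 : ℝ)
    · have hs : 0 < s₁ * s₂ := mul_pos h0 (by linarith)
      set q := √(s₁ * s₂) with hq
      have hq0 : 0 < q := Real.sqrt_pos.2 hs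
      have hq2 : q ^ 2 = s₁ * s₂ := Real.sq_sqrt hs.le
      have h : HasDerivAt
          (fun x => Real.arcsin (((s₁ + s₂) * x - 2 * (s₁ * s₂)) / (x * (s₂ - s₁))))
          (2 * (s₁ * s₂) / (x ^ 2 * (s₂ - s₁)) / (2 * q * R / (x * (s₂ - s₁)))) x := by
        refine hasDerivAt_arcsin_comp
          (f := fun x => ((s₁ + s₂) * x - 2 * (s₁ * s₂)) / (x * (s₂ - s₁))) ?_
          (by positivity) ?_
        · refine HasDerivAt.congr_deriv ((((hasDerivAt_id x).const_mul (s₁ + s₂)).sub_const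
            (2 * (s₁ * s₂))).div ((hasDerivAt_id x).mul_const (s₂ - s₁))
            (mul_pos hx0 hD).ne') ?_
          simp only [id]
          field_simp
          ring
        · rw [div_pow, div_pow, mul_pow, mul_pow, mul_pow, hR2, hq2]
          field_simp
          ring
      refine HasDerivAt.congr_deriv (h.const_mul q) ?_
      rw [← hq2]
      field_simp
  refine HasDerivAt.congr_deriv ((hd1.add (hd2.const_mul ((s₁ + s₂) / 2))).sub hd3) ?_
  field_simp
  rw [hR2]
  ring

lemma continuousOn_densityPrimitive (h₀ : 0 ≤ s₁) :
    ContinuousOn (densityPrimitive s₁ s₂) (Set.Icc s₁ s₂) := by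
  refine ContinuousOn.sub (by fun_prop) ?_
  rcases h₀.eq_or_lt with h0 | h0
  · subst h0
    simpa using continuousOn_const
  · rcases le_or_gt s₂ s₁ with h | h
    · exact (Set.subsingleton_Icc_of_ge h).continuousOn _
    · refine continuousOn_const.mul (Real.continuous_arcsin.comp_continuousOn
        (ContinuousOn.div (by fun_prop) (by fun_prop) fun x hx => ?_))
      exact (mul_pos (h0.trans_le hx.1) (by linarith)).ne'

lemma densityPrimitive_sub (h₀ : 0 ≤ s₁) (h : s₁ < s₂) :
    densityPrimitive s₁ s₂ s₂ - densityPrimitive s₁ s₂ s₁ =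
      Real.pi * ((s₁ + s₂) / 2 - √(s₁ * s₂)) := by
  have hD : s₂ - s₁ ≠ 0 := by linarith
  have hs₂ : s₂ ≠ 0 := by linarith
  have e1 : (2 * s₂ - s₁ - s₂) / (s₂ - s₁) = 1 := by field_simp; ring
  have e2 : (2 * s₁ - s₁ - s₂) / (s₂ - s₁) = -1 := by field_simp; ring
  have e3 : ((s₁ + s₂) * s₂ - 2 * (s₁ * s₂)) / (s₂ * (s₂ - s₁)) = 1 := by field_simp; ring
  have e4 : √(s₁ * s₂) * Real.arcsin (((s₁ + s₂) * s₁ - 2 * (s₁ * s₂)) / (s₁ * (s₂ - s₁))) =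
      √(s₁ * s₂) * -(Real.pi / 2) := by
    rcases h₀.eq_or_lt with h0 | h0
    · subst h0
      simp
    · have e5 : ((s₁ + s₂) * s₁ - 2 * (s₁ * s₂)) / (s₁ * (s₂ - s₁)) = -1 := by
        field_simp
        ring
      rw [e5, Real.arcsin_neg_one]
  simp only [densityPrimitive, e1, e2, e3, e4, Real.arcsin_one, Real.arcsin_neg_one, sub_self,
    zero_mul, mul_zero, Real.sqrt_zero]
  ring

lemma integral_density (h₀ : 0 ≤ s₁) {ξ : ℝ} (h₁ : s₁ ≤ ξ) (h₂ : ξ ≤ s₂) :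
    ∫ x in s₁..ξ, √((s₂ - x) * (x - s₁)) / x =
      densityPrimitive s₁ s₂ ξ - densityPrimitive s₁ s₂ s₁ := by
  have hc : ContinuousOn (densityPrimitive s₁ s₂) (Set.Icc s₁ ξ) :=
    (continuousOn_densityPrimitive h₀).mono (Set.Icc_subset_Icc_right h₂)
  have hd : ∀ x ∈ Set.Ioo s₁ ξ,
      HasDerivAt (densityPrimitive s₁ s₂) (√((s₂ - x) * (x - s₁)) / x) x := fun x hx =>
    hasDerivAt_densityPrimitive h₀ ⟨hx.1, hx.2.trans_le h₂⟩
  refine intervalIntegral.integral_eq_sub_of_hasDerivAt_of_le h₁ hc hd ?_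
  refine (intervalIntegrable_iff_integrableOn_Ioc_of_le h₁).2
    (intervalIntegral.integrableOn_deriv_of_nonneg hc hd fun x hx => ?_)
  exact div_nonneg (Real.sqrt_nonneg _) (h₀.trans hx.1.le)

end Primitive

/-! ### Asymptotics of the zeros -/

section Asymptotics

variable {α β : ℕ → ℝ} {b s₁ s₂ : ℝ}

lemma tendsto_jacobiPotential (hαlim : Tendsto (fun n : ℕ => α n / n) atTop atTop)
    (hβlim : Tendsto (fun n : ℕ => β n / n) atTop (𝓝 b)) {ξ : ℝ} (hξ : 0 < ξ) :
    Tendsto (fun p : ℕ × ℝ =>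
        jacobiPotential p.1 (α p.1) (β p.1) (p.1 / α p.1 * p.2 - 1) / α p.1 ^ 2)
      (atTop ×ˢ 𝓝 ξ) (𝓝 (-1 / 16 - b ^ 2 / (4 * ξ ^ 2) + (1 + b / 2) / (2 * ξ))) := by
  have hN : Tendsto (fun n : ℕ => 1 / (n : ℝ)) atTop (𝓝 0) := tendsto_one_div_atTop_nhds_zero_nat
  have hh : Tendsto (fun n : ℕ => (n : ℝ) / α n) atTop (𝓝 0) := by
    refine hαlim.inv_tendsto_atTop.congr fun n => ?_
    simp
  have hpos : ∀ᶠ n : ℕ in atTop, 0 < (n : ℝ) ∧ 0 < α n := by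
    filter_upwards [hαlim.eventually_gt_atTop 0, eventually_gt_atTop 0] with n h1 h2
    have h2' : (0 : ℝ) < n := by exact_mod_cast h2
    exact ⟨h2', (div_pos_iff_of_pos_right h2').1 h1⟩
  have hA : Tendsto (fun n : ℕ => 1 / α n) atTop (𝓝 0) := by
    have h := hh.mul hN
    rw [mul_zero] at h
    refine h.congr' ?_
    filter_upwards [hpos] with n hn
    have := hn.1.ne'
    field_simp
  have hN' := hN.comp (tendsto_fst (f := atTop) (g := 𝓝 ξ))
  have hh' := hh.comp (tendsto_fst (f := atTop) (g := 𝓝 ξ))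
  have hA' := hA.comp (tendsto_fst (f := atTop) (g := 𝓝 ξ))
  have hB' := hβlim.comp (tendsto_fst (f := atTop) (g := 𝓝 ξ))
  have hx : Tendsto (fun p : ℕ × ℝ => p.2) (atTop ×ˢ 𝓝 ξ) (𝓝 ξ) := tendsto_snd
  have h2 : Tendsto (fun p : ℕ × ℝ => 2 - (p.1 : ℝ) / α p.1 * p.2) (atTop ×ˢ 𝓝 ξ) (𝓝 2) := by
    simpa using (hh'.mul hx).const_sub 2
  have t1 := ((hA'.pow 2).sub_const 1).div ((h2.pow 2).const_mul 4) (by norm_num)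
  have t2 := ((hN'.pow 2).sub (hB'.pow 2)).div ((hx.pow 2).const_mul 4) (by positivity)
  have t3 := ((((hh'.add_const 1).add (hh'.mul hB')).add hA').add
    (((hA'.const_add 1).mul (hB'.add hN')).div_const 2)).div (hx.mul h2) (by positivity)
  have h := (t1.add t2).add t3
  rw [show (0 ^ 2 - 1) / (4 * 2 ^ 2) + (0 ^ 2 - b ^ 2) / (4 * ξ ^ 2) +
    (0 + 1 + 0 * b + 0 + (1 + 0) * (b + 0) / 2) / (ξ * 2) =
    -1 / 16 - b ^ 2 / (4 * ξ ^ 2) + (1 + b / 2) / (2 * ξ) by field_simp; ring] at h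
  refine h.congr' ?_
  filter_upwards [h2.eventually_const_lt (by norm_num : (0 : ℝ) < 2), hx.eventually_const_lt hξ,
    (tendsto_fst (f := atTop) (g := 𝓝 ξ)).eventually hpos] with ⟨n, x⟩ h1 h3 h4
  obtain ⟨hn, ha⟩ := h4
  simp only at h1 h3 hn ha
  have hd : 2 * α n - n * x ≠ 0 := by
    have : 2 * α n - n * x = α n * (2 - n / α n * x) := by field_simp
    rw [this]
    exact (mul_pos ha h1).ne'
  have e1 : 1 - ((n : ℝ) / α n * x - 1) = (2 * α n - n * x) / α n := by field_simp; ring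
  have e2 : 1 + ((n : ℝ) / α n * x - 1) = n * x / α n := by field_simp; ring
  have e3 : 1 - ((n : ℝ) / α n * x - 1) ^ 2 = (2 * α n - n * x) / α n * (n * x / α n) := by
    rw [← e1, ← e2]
    ring
  have e4 : 2 - (n : ℝ) / α n * x = (2 * α n - n * x) / α n := by field_simp
  simp only [jacobiPotential, Function.comp, e1, e2, e3, e4, Pi.div_apply]
  field_simp

variable (α β) in
/-- Number of zeros of `P_n` in the half-open interval with rescaled end points `x`, `y`. -/
noncomputable def zeroCount (n : ℕ) (x y : ℝ) : ℕ :=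
  {t | jacobiP n (α n) (β n) t = 0 ∧ t ∈ Set.Ioc (n / α n * x - 1) (n / α n * y - 1)}.ncard

lemma zeroCount_add_le (hα : ∀ n, α n > -1) {n : ℕ} (hn : 0 ≤ α n) {x y z : ℝ} (hxy : x ≤ y)
    (hyz : y ≤ z) : zeroCount α β n x y + zeroCount α β n y z ≤ zeroCount α β n x z := by
  have hfin := (jacobiP_zeros_finite (n := n) (β := β n) (hα n)).1
  have hh : (0 : ℝ) ≤ n / α n := by positivity
  have h1 := mul_le_mul_of_nonneg_left hxy hh
  have h2 := mul_le_mul_of_nonneg_left hyz hh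
  rw [zeroCount, zeroCount, ← Set.ncard_union_eq _ (hfin.subset fun t ht => ht.1)
    (hfin.subset fun t ht => ht.1)]
  · refine Set.ncard_le_ncard ?_ (hfin.subset fun t ht => ht.1)
    rintro t (⟨h, h3, h4⟩ | ⟨h, h3, h4⟩)
    · exact ⟨h, h3, by linarith⟩
    · exact ⟨h, by linarith, h4⟩
  · exact Set.disjoint_left.2 fun t h h' => absurd h'.2.1 (not_lt.2 h.2.2)

/-- The lower bound for the number of zeros near a point of the open bulk. -/
lemma exists_nhd_le_zeroCount (hα : ∀ n, α n > -1)
    (hαlim : Tendsto (fun n : ℕ => α n / n) atTop atTop)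
    (hβlim : Tendsto (fun n : ℕ => β n / n) atTop (𝓝 b))
    (h₀ : 0 ≤ s₁) (hsum : s₁ + s₂ = 4 * (2 + b)) (hprod : s₁ * s₂ = 4 * b ^ 2)
    {ξ ε : ℝ} (hξ : ξ ∈ Set.Ioo s₁ s₂) (hε : 0 < ε) :
    ∃ U : Set ℝ, IsOpen U ∧ ξ ∈ U ∧ ∀ x ∈ U, ∀ y ∈ U, x ≤ y → ∀ᶠ n : ℕ in atTop,
      n * (densityPrimitive s₁ s₂ y - densityPrimitive s₁ s₂ x - ε * (y - x)) ≤
        4 * Real.pi * zeroCount α β n x y := by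
  have hξ0 : 0 < ξ := h₀.trans_lt hξ.1
  have hpos : 0 < (s₂ - ξ) * (ξ - s₁) := mul_pos (sub_pos.2 hξ.2) (sub_pos.2 hξ.1)
  set g : ℝ → ℝ := fun x => √((s₂ - x) * (x - s₁)) / x with hg
  have hgξ : 0 < g ξ := div_pos (Real.sqrt_pos.2 hpos) hξ0
  have hgc : ContinuousAt g ξ :=
    ContinuousAt.div (by fun_prop) continuousAt_id hξ0.ne'
  obtain ⟨δ, hδ, hδε, hδg⟩ : ∃ δ : ℝ, 0 < δ ∧ δ ≤ ε / 4 ∧ δ < g ξ :=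
    ⟨min (ε / 4) (g ξ / 2), by positivity, min_le_left _ _,
      (min_le_right _ _).trans_lt (by linarith)⟩
  set ω := (g ξ - δ) / 4 with hω
  have hω0 : 0 < ω := by rw [hω]; linarith
  have hlim := tendsto_jacobiPotential hαlim hβlim hξ0
  have hval : -1 / 16 - b ^ 2 / (4 * ξ ^ 2) + (1 + b / 2) / (2 * ξ) = (g ξ / 4) ^ 2 := by
    rw [div_pow, hg]
    simp only
    rw [div_pow, Real.sq_sqrt hpos.le]
    field_simp
    linear_combination 64 * hprod - 64 * ξ * hsum
  rw [hval] at hlim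
  have hlt : ω ^ 2 < (g ξ / 4) ^ 2 := by
    apply pow_lt_pow_left₀ _ hω0.le two_ne_zero
    rw [hω]; linarith
  obtain ⟨pn, hpn, px, hpx, hpot⟩ := eventually_prod_iff.1 (hlim.eventually_const_lt hlt)
  have hnhd : ∀ᶠ x in 𝓝 ξ, px x ∧ g x < g ξ + δ ∧ x ∈ Set.Ioo s₁ s₂ :=
    hpx.and ((hgc.eventually_lt_const (by linarith)).and (isOpen_Ioo.mem_nhds hξ))
  obtain ⟨r, hr, hball⟩ := Metric.eventually_nhds_iff_ball.1 hnhd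
  refine ⟨Metric.ball ξ r, Metric.isOpen_ball, Metric.mem_ball_self hr, fun x hx y hy hxy => ?_⟩
  rw [Real.ball_eq_Ioo] at hx hy hball
  rcases hxy.eq_or_lt with rfl | hxy
  · refine Eventually.of_forall fun n => ?_
    simp only [sub_self, mul_zero]
    positivity
  have hsub : ∀ t ∈ Set.Icc x y, px t ∧ g t < g ξ + δ ∧ t ∈ Set.Ioo s₁ s₂ := fun t ht =>
    hball t ⟨hx.1.trans_le ht.1, ht.2.trans_lt hy.2⟩
  have hF : densityPrimitive s₁ s₂ y - densityPrimitive s₁ s₂ x ≤ (g ξ + δ) * (y - x) := by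
    obtain ⟨c, hc, hc'⟩ := exists_hasDerivAt_eq_slope (densityPrimitive s₁ s₂) g hxy
      (fun t ht => (hasDerivAt_densityPrimitive h₀ (hsub t ht).2.2).continuousAt.continuousWithinAt)
      (fun t ht => hasDerivAt_densityPrimitive h₀ (hsub t (Set.Ioo_subset_Icc_self ht)).2.2)
    have h1 := (hsub c (Set.Ioo_subset_Icc_self hc)).2.1
    rw [hc', div_lt_iff₀ (sub_pos.2 hxy)] at h1
    exact h1.le
  have hx0 : 0 < x := h₀.trans_lt (hsub x ⟨le_rfl, hxy.le⟩).2.2.1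
  have hyx : 0 < ε / 2 * (y - x) := mul_pos (by positivity) (sub_pos.2 hxy)
  have hbig := (tendsto_natCast_atTop_atTop (R := ℝ)).eventually_ge_atTop
    (4 * Real.pi / (ε / 2 * (y - x)))
  filter_upwards [hpn, hαlim.eventually_gt_atTop (y / 2), hbig, eventually_gt_atTop 0]
    with n hpn hαn hbig hn0
  have hn : (0 : ℝ) < n := by exact_mod_cast hn0
  have hαpos : 0 < α n := by
    have : 0 < α n / n := lt_trans (by linarith) hαn
    exact (div_pos_iff_of_pos_right hn).1 this
  have hh : (0 : ℝ) < n / α n := by positivity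
  rw [div_le_iff₀ hyx] at hbig
  set m := ⌊(n : ℝ) * ω * (y - x) / Real.pi⌋₊ with hm
  have hm1 : (m : ℝ) ≤ n * ω * (y - x) / Real.pi :=
    Nat.floor_le (div_nonneg (mul_nonneg (by positivity) (by linarith)) Real.pi_pos.le)
  have hm2 : (n : ℝ) * ω * (y - x) / Real.pi < m + 1 := Nat.lt_floor_add_one _
  have hcount : m ≤ zeroCount α β n x y := by
    refine le_ncard_jacobiP_zeros (ω := α n * ω) (hα n) (by positivity) ?_ ?_ ?_ m ?_
    · have := mul_pos hh hx0
      linarith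
    · rw [lt_div_iff₀ hn] at hαn
      have : (n : ℝ) / α n * y < 2 := by
        rw [div_mul_eq_mul_div, div_lt_iff₀ hαpos]
        linarith
      linarith
    · intro t ht
      have ht' : (t + 1) * (α n / n) ∈ Set.Icc x y := by
        have h1 : x = (n / α n * x) * (α n / n) := by field_simp
        have h2 : y = (n / α n * y) * (α n / n) := by field_simp
        have h3 : 0 ≤ α n / n := by positivity
        constructor
        · rw [h1]
          exact mul_le_mul_of_nonneg_right (by linarith [ht.1]) h3
        · rw [h2]
          exact mul_le_mul_of_nonneg_right (by linarith [ht.2]) h3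
      have h := hpot hpn (hsub _ ht').1
      have e : (n : ℝ) / α n * ((t + 1) * (α n / n)) - 1 = t := by field_simp; ring
      simp only [e] at h
      rw [lt_div_iff₀ (by positivity)] at h
      rw [mul_pow]
      linarith
    · have : (m : ℝ) * (Real.pi / (α n * ω)) ≤
          n * ω * (y - x) / Real.pi * (Real.pi / (α n * ω)) :=
        mul_le_mul_of_nonneg_right hm1 (by positivity)
      have e : (n : ℝ) * ω * (y - x) / Real.pi * (Real.pi / (α n * ω)) = n / α n * (y - x) := by
        field_simp
      linarith
  have hcount' : (m : ℝ) ≤ zeroCount α β n x y := by exact_mod_cast hcount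
  have hm3 : 4 * Real.pi * m ≤ 4 * Real.pi * zeroCount α β n x y :=
    mul_le_mul_of_nonneg_left hcount' (by positivity)
  rw [div_lt_iff₀ Real.pi_pos] at hm2
  have h1 : n * (densityPrimitive s₁ s₂ y - densityPrimitive s₁ s₂ x - ε * (y - x)) ≤
      n * ((g ξ + δ) * (y - x) - ε * (y - x)) :=
    mul_le_mul_of_nonneg_left (by linarith) hn.le
  have h2 : (n * (y - x)) * δ ≤ (n * (y - x)) * (ε / 4) :=
    mul_le_mul_of_nonneg_left hδε (mul_nonneg hn.le (by linarith))
  have h3 : (n : ℝ) * ω * (y - x) * 4 = n * (y - x) * (g ξ - δ) := by rw [hω]; ring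
  nlinarith

lemma eventually_le_zeroCount_of_mem_Ioo (hα : ∀ n, α n > -1)
    (hαlim : Tendsto (fun n : ℕ => α n / n) atTop atTop)
    (hβlim : Tendsto (fun n : ℕ => β n / n) atTop (𝓝 b))
    (h₀ : 0 ≤ s₁) (hsum : s₁ + s₂ = 4 * (2 + b)) (hprod : s₁ * s₂ = 4 * b ^ 2)
    {x y ε : ℝ} (hx : s₁ < x) (hxy : x ≤ y) (hy : y < s₂) (hε : 0 < ε) :
    ∀ᶠ n : ℕ in atTop,
      n * (densityPrimitive s₁ s₂ y - densityPrimitive s₁ s₂ x - ε * (y - x)) ≤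
        4 * Real.pi * zeroCount α β n x y := by
  choose U hUo hUm hU using fun ξ : Set.Icc x y =>
    exists_nhd_le_zeroCount hα hαlim hβlim h₀ hsum hprod (ξ := ξ)
      ⟨hx.trans_le ξ.2.1, ξ.2.2.trans_lt hy⟩ hε
  obtain ⟨t, ht0, htm, ⟨k, hk⟩, htU⟩ := exists_monotone_Icc_subset_open_cover_Icc hxy
    (c := fun ξ => Subtype.val ⁻¹' U ξ) (fun ξ => (hUo ξ).preimage continuous_subtype_val)
    (fun ξ _ => Set.mem_iUnion.2 ⟨ξ, hUm ξ⟩)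
  have key : ∀ j, ∀ᶠ n : ℕ in atTop,
      n * (densityPrimitive s₁ s₂ (t j) - densityPrimitive s₁ s₂ x - ε * (t j - x)) ≤
        4 * Real.pi * zeroCount α β n x (t j) := by
    intro j
    induction j with
    | zero =>
      refine Eventually.of_forall fun n => ?_
      simp only [ht0, sub_self, mul_zero]
      positivity
    | succ j ih =>
      obtain ⟨i, hi⟩ := htU j
      have hle : t j ≤ t (j + 1) := htm (Nat.le_succ j)
      filter_upwards [ih, hU i (t j) (hi ⟨le_rfl, hle⟩) (t (j + 1)) (hi ⟨hle, le_rfl⟩) hle,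
        hαlim.eventually_gt_atTop 0, eventually_gt_atTop 0] with n h1 h2 h3 h4
      have hn : (0 : ℝ) < n := by exact_mod_cast h4
      have h5 := zeroCount_add_le (β := β) hα ((div_pos_iff_of_pos_right hn).1 h3).le
        (t j).2.1 hle
      have h6 : (zeroCount α β n x (t j) : ℝ) + zeroCount α β n (t j) (t (j + 1)) ≤
          zeroCount α β n x (t (j + 1)) := by exact_mod_cast h5
      have h7 := mul_le_mul_of_nonneg_left h6 (by positivity : 0 ≤ 4 * Real.pi)
      linarith
  have h := key k
  rwa [hk k le_rfl] at h

lemma eventually_le_zeroCount (hα : ∀ n, α n > -1)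
    (hαlim : Tendsto (fun n : ℕ => α n / n) atTop atTop)
    (hβlim : Tendsto (fun n : ℕ => β n / n) atTop (𝓝 b))
    (h₀ : 0 ≤ s₁) (hsum : s₁ + s₂ = 4 * (2 + b)) (hprod : s₁ * s₂ = 4 * b ^ 2)
    {x y ε : ℝ} (hx : s₁ ≤ x) (hxy : x ≤ y) (hy : y ≤ s₂) (hε : 0 < ε) :
    ∀ᶠ n : ℕ in atTop,
      n * (densityPrimitive s₁ s₂ y - densityPrimitive s₁ s₂ x - ε) ≤
        4 * Real.pi * zeroCount α β n x y := by
  rcases hxy.eq_or_lt with rfl | hxy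
  · refine Eventually.of_forall fun n => le_trans (b := 0) ?_ (by positivity)
    exact mul_nonpos_of_nonneg_of_nonpos n.cast_nonneg (by linarith)
  have hcont : ContinuousOn (densityPrimitive s₁ s₂) (Set.Icc x y) :=
    (continuousOn_densityPrimitive h₀).mono (Set.Icc_subset_Icc hx hy)
  obtain ⟨z, hz1, hz2⟩ := exists_between hxy
  obtain ⟨c, hFc, hc1, hc2⟩ : ∃ c, densityPrimitive s₁ s₂ c < densityPrimitive s₁ s₂ x + ε / 3 ∧
      x < c ∧ c < z := by
    have h := hcont x ⟨le_rfl, hxy.le⟩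
    rw [ContinuousWithinAt, nhdsWithin_Icc_eq_nhdsGE hxy] at h
    exact (((h.mono_left (nhdsWithin_mono _ Set.Ioi_subset_Ici_self)).eventually_lt_const
      (by linarith)).and (Ioo_mem_nhdsGT hz1)).exists
  obtain ⟨d, hFd, hd1, hd2⟩ : ∃ d, densityPrimitive s₁ s₂ y - ε / 3 < densityPrimitive s₁ s₂ d ∧
      z < d ∧ d < y := by
    have h := hcont y ⟨hxy.le, le_rfl⟩
    rw [ContinuousWithinAt, nhdsWithin_Icc_eq_nhdsLE hxy] at h
    exact (((h.mono_left (nhdsWithin_mono _ Set.Iio_subset_Iic_self)).eventually_const_lt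
      (by linarith)).and (Ioo_mem_nhdsLT hz2)).exists
  have hcd : 0 < d - c := by linarith
  filter_upwards [eventually_le_zeroCount_of_mem_Ioo hα hαlim hβlim h₀ hsum hprod
    (x := c) (y := d) (ε := ε / 3 / (d - c)) (by linarith) (by linarith) (by linarith)
    (by positivity), hαlim.eventually_gt_atTop 0, eventually_gt_atTop 0] with n h1 h2 h3
  have hn : (0 : ℝ) < n := by exact_mod_cast h3
  have hα0 := ((div_pos_iff_of_pos_right hn).1 h2).le
  rw [div_mul_cancel₀ _ hcd.ne'] at h1
  have h4 := zeroCount_add_le (β := β) hα hα0 hc1.le (by linarith : c ≤ d)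
  have h5 := zeroCount_add_le (β := β) hα hα0 (by linarith : x ≤ d) hd2.le
  have h6 : (zeroCount α β n c d : ℝ) ≤ zeroCount α β n x y := by
    exact_mod_cast (by omega : zeroCount α β n c d ≤ zeroCount α β n x y)
  calc n * (densityPrimitive s₁ s₂ y - densityPrimitive s₁ s₂ x - ε)
      ≤ n * (densityPrimitive s₁ s₂ d - densityPrimitive s₁ s₂ c - ε / 3) :=
        mul_le_mul_of_nonneg_left (by linarith) hn.le
    _ ≤ 4 * Real.pi * zeroCount α β n c d := h1
    _ ≤ _ := mul_le_mul_of_nonneg_left h6 (by positivity)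

end Asymptotics

theorem stmt4 (α β : ℕ → ℝ) (b : ℝ) (hb : 0 ≤ b)
    (hα : ∀ n, α n > -1) (hβ : ∀ n, β n > -1)
    (hαlim : Tendsto (fun n : ℕ => α n / n) atTop atTop)
    (hβlim : Tendsto (fun n : ℕ => β n / n) atTop (𝓝 b))
    (s1 s2 : ℝ)
    (hs1 : s1 = 2 * (2 + b) - 4 * Real.sqrt (1 + b))
    (hs2 : s2 = 2 * (2 + b) + 4 * Real.sqrt (1 + b))
    (ξ : ℝ) (hξ1 : s1 ≤ ξ) (hξ2 : ξ ≤ s2) :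
    Tendsto (fun n : ℕ =>
        (jacobiN n (α n) (β n) ((n : ℝ) / α n * ξ - 1) : ℝ) / n)
      atTop (𝓝 (1 / (4 * Real.pi) *
        ∫ x in s1..ξ, Real.sqrt ((s2 - x) * (x - s1)) / x)) := by
  have hsq : √(1 + b) ^ 2 = 1 + b := Real.sq_sqrt (by linarith)
  have hsqpos : 0 < √(1 + b) := Real.sqrt_pos.2 (by linarith)
  have hsum : s1 + s2 = 4 * (2 + b) := by rw [hs1, hs2]; ring
  have hprod : s1 * s2 = 4 * b ^ 2 := by
    rw [hs1, hs2]
    linear_combination (-16) * hsq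
  have h₀ : 0 ≤ s1 := by
    rw [hs1]
    nlinarith [sq_nonneg (√(1 + b) - 1)]
  have hlt : s1 < s2 := by rw [hs1, hs2]; linarith
  have htot : densityPrimitive s1 s2 s2 - densityPrimitive s1 s2 s1 = 4 * Real.pi := by
    rw [densityPrimitive_sub h₀ hlt, hsum, hprod, show 4 * b ^ 2 = (2 * b) ^ 2 by ring,
      Real.sqrt_sq (by linarith)]
    ring
  rw [integral_density h₀ hξ1 hξ2, Metric.tendsto_nhds]
  intro ε hε
  have hε' : 0 < 2 * Real.pi * ε := by positivity
  filter_upwards [eventually_le_zeroCount hα hαlim hβlim h₀ hsum hprod le_rfl hξ1 hξ2 hε',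
    eventually_le_zeroCount hα hαlim hβlim h₀ hsum hprod hξ1 hξ2 le_rfl hε',
    eventually_gt_atTop 0] with n h1 h2 h3
  have hn : (0 : ℝ) < n := by exact_mod_cast h3
  obtain ⟨hfin, hcard⟩ := jacobiP_zeros_finite (n := n) (β := β n) (hα n)
  set N := jacobiN n (α n) (β n) ((n : ℝ) / α n * ξ - 1) with hN
  have hlow : zeroCount α β n s1 ξ ≤ N :=
    Set.ncard_le_ncard (fun t ht => ⟨ht.1, ht.2.2⟩) (hfin.subset fun t ht => ht.1)
  have hupp : N + zeroCount α β n ξ s2 ≤ n := by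
    refine le_trans ?_ hcard
    rw [hN, jacobiN, zeroCount, ← Set.ncard_union_eq
      (Set.disjoint_left.2 fun t h h' => absurd h'.2.1 (not_lt.2 h.2))
      (hfin.subset fun t ht => ht.1) (hfin.subset fun t ht => ht.1)]
    exact Set.ncard_le_ncard (Set.union_subset (fun t ht => ht.1) fun t ht => ht.1) hfin
  have hlow' : (zeroCount α β n s1 ξ : ℝ) ≤ N := by exact_mod_cast hlow
  have hupp' : (N : ℝ) + zeroCount α β n ξ s2 ≤ n := by exact_mod_cast hupp
  have h4 : 0 < 4 * Real.pi := by positivity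
  have h5 := mul_le_mul_of_nonneg_left hlow' h4.le
  have h6 := mul_le_mul_of_nonneg_left hupp' h4.le
  have hpn : 0 < n * Real.pi * ε := by positivity
  have hs : densityPrimitive s1 s2 s2 = densityPrimitive s1 s2 s1 + 4 * Real.pi := by linarith
  rw [hs] at h2
  rw [Real.dist_eq, show (N : ℝ) / n - 1 / (4 * Real.pi) *
    (densityPrimitive s1 s2 ξ - densityPrimitive s1 s2 s1) =
    (4 * Real.pi * N - n * (densityPrimitive s1 s2 ξ - densityPrimitive s1 s2 s1)) /
      (4 * Real.pi * n) by field_simp, abs_div, abs_of_pos (mul_pos h4 hn),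
    div_lt_iff₀ (mul_pos h4 hn), abs_lt]
  constructor <;> nlinarith
end

section
/- Let (α_n) and (β_n) be sequences with α_n, β_n > −1 such that α_n/n → ∞, β_n/n → ∞ and α_n/β_n → ∞ as n → ∞. Then for every ξ with −2 ≤ ξ ≤ 6, lim_{n→∞} (1/n)·N^{(α_n,β_n)}((√(n·β_n)/α_n)·ξ − (α_n + 2√(n·β_n) − β_n)/(2n+α_n+β_n)) = (1/(8π)) · ∫_{−2}^{ξ} √((6−x)(x+2)) dx. -/
open Filter Topology

open Polynomial in
/-- The Jacobi polynomial `P_n^{(a - n, b - n)}`. The parameters `a`, `b` are chosen so that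
differentiation and the raising operator leave them unchanged. -/
noncomputable def jacobiPoly (n : ℕ) (a b : ℝ) : ℝ[X] :=
  ∑ p ∈ Finset.HasAntidiagonal.antidiagonal n, C (genBinom a p.2 * genBinom b p.1) *
    ((C (1 / 2) * (X - 1)) ^ p.1 * (C (1 / 2) * (X + 1)) ^ p.2)

lemma genBinom_succ (t : ℝ) (m : ℕ) :
    ((m : ℝ) + 1) * genBinom t (m + 1) = (t - m) * genBinom t m := by
  have h : ((m.factorial : ℕ) : ℝ) ≠ 0 := by exact_mod_cast m.factorial_ne_zero
  have h' : (m : ℝ) + 1 ≠ 0 := by positivity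
  simp only [genBinom, Finset.prod_range_succ, Nat.factorial_succ]
  push_cast
  field_simp

lemma eval_jacobiPoly (n : ℕ) (α β x : ℝ) :
    (jacobiPoly n (n + α) (n + β)).eval x = jacobiP n α β x := by
  simp only [jacobiPoly, jacobiP, Polynomial.eval_finsetSum]
  rw [Finset.Nat.sum_antidiagonal_eq_sum_range_succ_mk]
  refine Finset.sum_congr rfl fun k _ => ?_
  simp
  ring

lemma derivative_jacobiPoly_succ (n : ℕ) (a b : ℝ) :
    Polynomial.derivative (jacobiPoly (n + 1) a b) =
      Polynomial.C ((a + b - n) / 2) * jacobiPoly n a b := by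
  apply Polynomial.funext
  intro x
  simp only [jacobiPoly, Polynomial.derivative_sum, Polynomial.eval_finsetSum,
    Polynomial.eval_mul, Polynomial.eval_C]
  have h : ∀ p : ℕ × ℕ, Polynomial.eval x (Polynomial.derivative
      (Polynomial.C (genBinom a p.2 * genBinom b p.1) *
      ((Polynomial.C (1 / 2) * (Polynomial.X - 1)) ^ p.1 *
        (Polynomial.C (1 / 2) * (Polynomial.X + 1)) ^ p.2))) =
      genBinom a p.2 * (p.1 * genBinom b p.1) / 2 *
        (((x - 1) / 2) ^ (p.1 - 1) * ((x + 1) / 2) ^ p.2) +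
      p.2 * genBinom a p.2 * genBinom b p.1 / 2 *
        (((x - 1) / 2) ^ p.1 * ((x + 1) / 2) ^ (p.2 - 1)) := by
    intro p
    simp [Polynomial.derivative_mul, Polynomial.derivative_pow]
    ring
  simp only [h, Finset.sum_add_distrib]
  rw [Finset.Nat.sum_antidiagonal_succ, Finset.Nat.sum_antidiagonal_succ' (n := n)]
  simp only [Nat.cast_zero, zero_mul, mul_zero, zero_div, zero_add,
    Nat.add_sub_cancel, Nat.cast_add, Nat.cast_one, genBinom_succ]
  rw [← Finset.sum_add_distrib, Finset.mul_sum]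
  refine Finset.sum_congr rfl fun p hp => ?_
  have : (n : ℝ) = p.1 + p.2 :=
    by exact_mod_cast (Finset.HasAntidiagonal.mem_antidiagonal.mp hp).symm
  rw [this]
  simp
  ring

lemma jacobiPoly_raising (n : ℕ) (a b x : ℝ) :
    ((b - n) * (1 - x) - (a - n) * (1 + x)) * (jacobiPoly n a b).eval x +
      (1 - x ^ 2) * (Polynomial.derivative (jacobiPoly n a b)).eval x =
      -2 * (n + 1) * (jacobiPoly (n + 1) a b).eval x := by
  obtain ⟨u, hu⟩ : ∃ u, u = (x - 1) / 2 := ⟨_, rfl⟩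
  obtain ⟨v, hv⟩ : ∃ v, v = (x + 1) / 2 := ⟨_, rfl⟩
  have hv' : (2⁻¹ : ℝ) * (x + 1) = v := by rw [hv]; ring
  have hu' : (2⁻¹ : ℝ) * (x - 1) = u := by rw [hu]; ring
  have hx : x = 2 * u + 1 := by rw [hu]; ring
  have e : ∀ m, (jacobiPoly m a b).eval x = ∑ p ∈ Finset.HasAntidiagonal.antidiagonal m,
      genBinom a p.2 * genBinom b p.1 * (u ^ p.1 * v ^ p.2) := by
    intro m
    simp only [jacobiPoly, Polynomial.eval_finsetSum]
    refine Finset.sum_congr rfl fun p _ => ?_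
    simp [hu', hv']
  have ed : (1 - x ^ 2) * (Polynomial.derivative (jacobiPoly n a b)).eval x =
      ∑ p ∈ Finset.HasAntidiagonal.antidiagonal n, -2 * (genBinom a p.2 * genBinom b p.1) *
        (p.1 * (u ^ p.1 * v ^ (p.2 + 1)) + p.2 * (u ^ (p.1 + 1) * v ^ p.2)) := by
    simp only [jacobiPoly, Polynomial.derivative_sum, Polynomial.eval_finsetSum, Finset.mul_sum]
    refine Finset.sum_congr rfl fun p _ => ?_
    have h1 : (p.1 : ℝ) * u ^ p.1 = p.1 * u ^ (p.1 - 1) * u := by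
      rcases p.1 with _ | i
      · simp
      · simp [pow_succ]; ring
    have h2 : (p.2 : ℝ) * v ^ p.2 = p.2 * v ^ (p.2 - 1) * v := by
      rcases p.2 with _ | i
      · simp
      · simp [pow_succ]; ring
    have h3 : 1 - x ^ 2 = -4 * u * v := by rw [hu, hv]; ring
    rw [h3]
    simp [Polynomial.derivative_mul, Polynomial.derivative_pow, hu', hv']
    linear_combination (-2 * genBinom a p.2 * genBinom b p.1 * v * v ^ p.2) * h1 +
      (-2 * genBinom a p.2 * genBinom b p.1 * u * u ^ p.1) * h2
  have es : ((n : ℝ) + 1) * (jacobiPoly (n + 1) a b).eval x =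
      ∑ p ∈ Finset.HasAntidiagonal.antidiagonal (n + 1), genBinom a p.2 * (p.1 * genBinom b p.1) *
        (u ^ p.1 * v ^ p.2) +
      ∑ p ∈ Finset.HasAntidiagonal.antidiagonal (n + 1), p.2 * genBinom a p.2 * genBinom b p.1 *
        (u ^ p.1 * v ^ p.2) := by
    rw [e, Finset.mul_sum, ← Finset.sum_add_distrib]
    refine Finset.sum_congr rfl fun p hp => ?_
    have : (n : ℝ) + 1 = p.1 + p.2 :=
      by exact_mod_cast (Finset.HasAntidiagonal.mem_antidiagonal.mp hp).symm
    rw [this]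
    ring
  rw [Finset.Nat.sum_antidiagonal_succ, Finset.Nat.sum_antidiagonal_succ' (n := n)] at es
  simp only [Nat.cast_zero, zero_mul, mul_zero, zero_add,
    Nat.cast_add, Nat.cast_one, genBinom_succ] at es
  rw [ed, mul_assoc, es, e, ← Finset.sum_add_distrib, Finset.mul_sum, Finset.mul_sum,
    ← Finset.sum_add_distrib]
  refine Finset.sum_congr rfl fun p hp => ?_
  have : (n : ℝ) = p.1 + p.2 :=
    by exact_mod_cast (Finset.HasAntidiagonal.mem_antidiagonal.mp hp).symm
  rw [this, hx]
  have hv2 : v = u + 1 := by rw [hu, hv]; ring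
  simp only [pow_succ]
  rw [show 1 - (2 * u + 1) = -2 * u by ring, show 1 + (2 * u + 1) = 2 * v by rw [hv2]; ring]
  ring

lemma natDegree_jacobiPoly_le (n : ℕ) (a b : ℝ) : (jacobiPoly n a b).natDegree ≤ n := by
  refine Polynomial.natDegree_sum_le_of_forall_le _ _ fun p hp => ?_
  rw [← Finset.HasAntidiagonal.mem_antidiagonal.mp hp]
  compute_degree

lemma jacobiPoly_ne_zero {n : ℕ} {a b : ℝ} (ha : n - 1 < a) : jacobiPoly n a b ≠ 0 := by
  intro h
  have h1 : (jacobiPoly n a b).eval 1 = genBinom a n := by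
    simp only [jacobiPoly, Polynomial.eval_finsetSum]
    rw [Finset.Nat.sum_antidiagonal_eq_sum_range_succ_mk, Finset.sum_range_succ']
    simp [genBinom]
    norm_num
  rw [h, Polynomial.eval_zero, genBinom, eq_comm, div_eq_zero_iff] at h1
  rcases h1 with h1 | h1
  · obtain ⟨i, hi, h0⟩ := Finset.prod_eq_zero_iff.mp h1
    have : (i : ℝ) + 1 ≤ n := by exact_mod_cast Finset.mem_range.mp hi
    linarith
  · exact n.factorial_ne_zero (by exact_mod_cast h1)

/-- The zeros of `P_m`, listed increasingly between the end points `-1` and `1`. -/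
lemma exists_zeros_jacobiPoly (a b : ℝ) (m : ℕ) (ha : (m : ℝ) - 1 < a) (hb : (m : ℝ) - 1 < b) :
    ∃ x : ℕ → ℝ, x 0 = -1 ∧ x (m + 1) = 1 ∧ (∀ i ≤ m, x i < x (i + 1)) ∧
      ∀ i, 1 ≤ i → i ≤ m → (jacobiPoly m a b).eval (x i) = 0 := by
  induction m with
  | zero =>
    refine ⟨fun i => 2 * i - 1, by simp, by norm_num, fun i _ => by push_cast; linarith, ?_⟩
    intro i h1 h2
    omega
  | succ m ih =>
    push_cast at ha hb
    obtain ⟨x, hx0, hx1, hlt, hz⟩ := ih (by linarith) (by linarith)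
    have hge : ∀ i ≤ m + 1, -1 ≤ x i := by
      intro i
      induction i with
      | zero => intro _; exact hx0.ge
      | succ i hi => intro h; exact (hi (by omega)).trans (hlt i (by omega)).le
    have hle : ∀ j ≤ m + 1, x (m + 1 - j) ≤ 1 := by
      intro j
      induction j with
      | zero => intro _; exact hx1.le
      | succ j hj =>
        intro h
        have := hlt (m + 1 - (j + 1)) (by omega)
        rw [show m + 1 - (j + 1) + 1 = m + 1 - j by omega] at this
        exact this.le.trans (hj (by omega))
    have hle' : ∀ i ≤ m + 1, x i ≤ 1 := fun i hi => by
      simpa [Nat.sub_sub_self hi] using hle (m + 1 - i) (by omega)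
    set f : ℝ → ℝ := fun y => (1 - y) ^ (a - m) * (1 + y) ^ (b - m) * (jacobiPoly m a b).eval y
      with hf
    have hfc : Continuous f := by
      refine Continuous.mul (Continuous.mul ?_ ?_) (Polynomial.continuous _)
      · exact (continuous_const.sub continuous_id).rpow_const fun _ => Or.inr (by linarith)
      · exact (continuous_const.add continuous_id).rpow_const fun _ => Or.inr (by linarith)
    have hf0 : ∀ i ≤ m + 1, f (x i) = 0 := by
      intro i hi
      rcases Nat.eq_zero_or_pos i with rfl | h0
      · simp [hf, hx0, Real.zero_rpow (show b - m ≠ 0 by linarith)]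
      · rcases hi.lt_or_eq with h | rfl
        · simp [hf, hz i h0 (by omega)]
        · simp [hf, hx1, Real.zero_rpow (show a - m ≠ 0 by linarith)]
    have hfd : ∀ y ∈ Set.Ioo (-1 : ℝ) 1, HasDerivAt f ((1 - y) ^ (a - m - 1) *
        (1 + y) ^ (b - m - 1) * (-2 * (m + 1) * (jacobiPoly (m + 1) a b).eval y)) y := by
      intro y hy
      have p1 : 0 < 1 - y := by linarith [hy.2]
      have p2 : 0 < 1 + y := by linarith [hy.1]
      have d1 : HasDerivAt (fun y : ℝ => (1 - y) ^ (a - m)) _ y :=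
        ((hasDerivAt_id y).const_sub 1).rpow_const (Or.inl p1.ne')
      have d2 : HasDerivAt (fun y : ℝ => (1 + y) ^ (b - m)) _ y :=
        ((hasDerivAt_id y).const_add 1).rpow_const (Or.inl p2.ne')
      refine ((d1.mul d2).mul ((jacobiPoly m a b).hasDerivAt y)).congr_deriv ?_
      rw [← jacobiPoly_raising]
      have e1 : (1 - y) ^ (a - m) = (1 - y) ^ (a - m - 1) * (1 - y) := by
        rw [← Real.rpow_add_one p1.ne']; ring_nf
      have e2 : (1 + y) ^ (b - m) = (1 + y) ^ (b - m - 1) * (1 + y) := by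
        rw [← Real.rpow_add_one p2.ne']; ring_nf
      simp only [id, Pi.mul_apply]
      rw [e1, e2]
      ring
    have hroll : ∀ i ≤ m, ∃ y ∈ Set.Ioo (x i) (x (i + 1)), (jacobiPoly (m + 1) a b).eval y = 0 := by
      intro i hi
      have hsub : ∀ y ∈ Set.Ioo (x i) (x (i + 1)), y ∈ Set.Ioo (-1 : ℝ) 1 := fun y hy =>
        ⟨(hge i (by omega)).trans_lt hy.1, hy.2.trans_le (hle' (i + 1) (by omega))⟩
      obtain ⟨y, hy, h0⟩ := exists_hasDerivAt_eq_zero (hlt i hi) hfc.continuousOn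
        ((hf0 i (by omega)).trans (hf0 (i + 1) (by omega)).symm) fun y hy => hfd y (hsub y hy)
      refine ⟨y, hy, ?_⟩
      have p1 : 0 < 1 - y := by linarith [(hsub y hy).2]
      have p2 : 0 < 1 + y := by linarith [(hsub y hy).1]
      have p3 : (-2 : ℝ) * (m + 1) ≠ 0 := by
        have : (0 : ℝ) < m + 1 := by positivity
        linarith
      simpa [(Real.rpow_pos_of_pos p1 _).ne', (Real.rpow_pos_of_pos p2 _).ne',
        Nat.cast_add_one_ne_zero] using h0
    choose! y hy hy0 using hroll
    refine ⟨fun i => if i = 0 then -1 else if i ≤ m + 1 then y (i - 1) else 1, by simp, by simp,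
      ?_, ?_⟩
    · intro i hi
      rcases Nat.eq_zero_or_pos i with rfl | h0
      · simpa [hx0] using (hy 0 (by omega)).1
      · obtain ⟨i, rfl⟩ : ∃ j, i = j + 1 := ⟨i - 1, by omega⟩
        have h1 := hy i (by omega)
        rcases hi.lt_or_eq with h | h
        · have h2 := hy (i + 1) (by omega)
          simpa [show i ≤ m by omega, show i + 1 ≤ m by omega] using h1.2.trans h2.1
        · obtain rfl : i = m := by omega
          simpa [hx1] using h1.2
    · intro i h1 h2
      simp only [show i ≠ 0 by omega, h2, if_true, if_false]
      exact hy0 _ (by omega)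

/-- The zero set of `P_m` consists of `m` points. -/
lemma exists_finset_zeros_jacobiPoly (a b : ℝ) (m : ℕ) (ha : (m : ℝ) - 1 < a)
    (hb : (m : ℝ) - 1 < b) :
    ∃ S : Finset ℝ, S.card = m ∧ (∀ x, x ∈ S ↔ (jacobiPoly m a b).eval x = 0) ∧
      (jacobiPoly m a b).roots = S.val ∧ (jacobiPoly m a b).Splits := by
  obtain ⟨x, -, -, hlt, hz⟩ := exists_zeros_jacobiPoly a b m ha hb
  have hne := jacobiPoly_ne_zero (b := b) ha
  have hmono : ∀ i j, i < j → j ≤ m + 1 → x i < x j := by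
    intro i j hij
    induction j, hij using Nat.le_induction with
    | base => intro h; exact hlt i (by omega)
    | succ j hj ih => intro h; exact (ih (by omega)).trans (hlt j (by omega))
  have hinj : Set.InjOn x (Finset.Icc 1 m : Finset ℕ) := by
    intro i hi j hj hij
    simp only [Finset.coe_Icc, Set.mem_Icc] at hi hj
    rcases lt_trichotomy i j with h | h | h
    · exact absurd hij (hmono i j h (by omega)).ne
    · exact h
    · exact absurd hij (hmono j i h (by omega)).ne'
  have hcard : ((Finset.Icc 1 m).image x).card = m := by
    rw [Finset.card_image_of_injOn hinj]; simp
  have hle : ((Finset.Icc 1 m).image x).val ≤ (jacobiPoly m a b).roots := by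
    rw [Multiset.le_iff_subset (Finset.nodup _)]
    intro y hy
    obtain ⟨i, hi, rfl⟩ := Finset.mem_image.mp (Finset.mem_val.mp hy)
    rw [Finset.mem_Icc] at hi
    exact (Polynomial.mem_roots hne).mpr (hz i hi.1 hi.2)
  have hdeg := natDegree_jacobiPoly_le m a b
  have hroots := (Polynomial.card_roots' (jacobiPoly m a b))
  have heq := Multiset.eq_of_le_of_card_le hle (by
    rw [Finset.card_val, hcard]; omega)
  have hcr : (jacobiPoly m a b).roots.card = m := by rw [← heq, Finset.card_val, hcard]
  refine ⟨_, hcard, fun y => ?_, heq.symm, ?_⟩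
  · rw [← Finset.mem_val, heq, Polynomial.mem_roots hne, Polynomial.IsRoot]
  · exact Polynomial.splits_iff_card_roots.mpr (by omega)

/-- The electrostatic (Stieltjes) equilibrium relations for the zeros of a Jacobi polynomial. -/
lemma sum_inv_sub_zeros_jacobiPoly {a b : ℝ} {m : ℕ} {S : Finset ℝ}
    (hS : (jacobiPoly m a b).roots = S.val) (hs : (jacobiPoly m a b).Splits)
    (hne : jacobiPoly m a b ≠ 0) {x : ℝ} (hx : x ∈ S) :
    (1 - x ^ 2) * ∑ y ∈ S.erase x, 2 / (x - y) =
      (a - m + 1) * (1 + x) - (b - m + 1) * (1 - x) := by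
  obtain ⟨Q, hQ⟩ : ∃ Q, jacobiPoly m a b = (Polynomial.X - Polynomial.C x) * Q := by
    have : (jacobiPoly m a b).IsRoot x := by
      apply Polynomial.isRoot_of_mem_roots
      rw [hS]; exact hx
    exact Polynomial.dvd_iff_isRoot.mpr this
  have hQ0 : Q ≠ 0 := by rintro rfl; simp at hQ; exact hne hQ
  have hQr : Q.roots = (S.erase x).val := by
    have h1 : (jacobiPoly m a b).roots = {x} + Q.roots := by
      rw [hQ, Polynomial.roots_mul (by rw [← hQ]; exact hne), Polynomial.roots_X_sub_C]
    rw [Finset.erase_val, ← hS, h1]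
    simp
  have hQs : Q.Splits := by
    rw [hQ] at hs
    exact ((Polynomial.splits_mul (Polynomial.X_sub_C_ne_zero x) hQ0).mp hs).2
  have hQx : Q.eval x ≠ 0 := by
    intro h
    have : x ∈ Q.roots := (Polynomial.mem_roots hQ0).mpr h
    rw [hQr] at this
    exact Finset.notMem_erase x S this
  have hsum := hQs.eval_derivative_eq_eval_mul_sum hQx
  rw [hQr] at hsum
  change _ = _ * ∑ y ∈ S.erase x, 1 / (x - y) at hsum
  have hS2 : ∑ y ∈ S.erase x, 2 / (x - y) = 2 * ∑ y ∈ S.erase x, 1 / (x - y) := by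
    rw [Finset.mul_sum]
    exact Finset.sum_congr rfl fun y _ => by ring
  have hd1 : (Polynomial.derivative (jacobiPoly m a b)).eval x = Q.eval x := by
    rw [hQ]; simp
  have hd2 : (Polynomial.derivative (Polynomial.derivative (jacobiPoly m a b))).eval x =
      2 * (Polynomial.derivative Q).eval x := by
    rw [hQ]; simp; ring
  have hP : (jacobiPoly m a b).eval x = 0 := by rw [hQ]; simp
  rcases m with _ | m
  · simp [jacobiPoly, genBinom] at hP
  rw [derivative_jacobiPoly_succ] at hd1 hd2
  simp only [Polynomial.derivative_C_mul, Polynomial.eval_mul, Polynomial.eval_C] at hd1 hd2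
  have hr := jacobiPoly_raising m a b x
  rw [hP, mul_zero] at hr
  rw [hS2]
  apply mul_left_cancel₀ hQx
  push_cast
  linear_combination (2 * x ^ 2 - 2) * hsum + ((a + b - m) / 2) * hr - (1 - x ^ 2) * hd2 -
    ((b - m) * (1 - x) - (a - m) * (1 + x)) * hd1

/-- The moments of the semicircle law of radius `4`. -/
noncomputable def semicircleMoment (k : ℕ) : ℝ :=
  if Even k then 4 ^ (k / 2) * (catalan (k / 2) : ℝ) else 0

lemma semicircleMoment_even (m : ℕ) : semicircleMoment (2 * m) = 4 ^ m * (catalan m : ℝ) := by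
  simp [semicircleMoment]

lemma semicircleMoment_odd (m : ℕ) : semicircleMoment (2 * m + 1) = 0 := by
  simp [semicircleMoment]

lemma semicircleMoment_add_two (k : ℕ) : semicircleMoment (k + 2) =
    4 * ∑ p ∈ Finset.HasAntidiagonal.antidiagonal k,
      semicircleMoment p.1 * semicircleMoment p.2 := by
  rcases Nat.even_or_odd' k with ⟨m, rfl | rfl⟩
  · rw [show 2 * m + 2 = 2 * (m + 1) by ring, semicircleMoment_even, catalan_succ']
    have : ∑ p ∈ Finset.HasAntidiagonal.antidiagonal (2 * m),
        semicircleMoment p.1 * semicircleMoment p.2 =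
        ∑ p ∈ Finset.HasAntidiagonal.antidiagonal m,
          semicircleMoment (2 * p.1) * semicircleMoment (2 * p.2) := by
      symm
      refine Finset.sum_of_injOn (fun p => (2 * p.1, 2 * p.2)) ?_ ?_ ?_ ?_
      · rintro ⟨a, b⟩ _ ⟨c, d⟩ _ h
        simp only [Prod.mk.injEq] at h ⊢
        omega
      · rintro ⟨a, b⟩ h
        simp only [Finset.mem_coe, Finset.HasAntidiagonal.mem_antidiagonal] at h ⊢
        omega
      · rintro ⟨a, b⟩ h h'
        rw [Finset.HasAntidiagonal.mem_antidiagonal] at h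
        rcases Nat.even_or_odd' a with ⟨i, rfl | rfl⟩
        · refine absurd ⟨(i, m - i), ?_, ?_⟩ h'
          · simp only [Finset.mem_coe, Finset.HasAntidiagonal.mem_antidiagonal] at h ⊢
            omega
          · simp only [Prod.mk.injEq, true_and] at h ⊢
            omega
        · simp [semicircleMoment_odd]
      · intro p _
        rfl
    rw [this]
    push_cast
    rw [Finset.mul_sum, Finset.mul_sum]
    refine Finset.sum_congr rfl fun p hp => ?_
    rw [semicircleMoment_even, semicircleMoment_even,
      ← Finset.HasAntidiagonal.mem_antidiagonal.mp hp]
    ring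
  · rw [show 2 * m + 1 + 2 = 2 * (m + 1) + 1 by ring, semicircleMoment_odd,
      Finset.sum_eq_zero, mul_zero]
    rintro ⟨a, b⟩ h
    rw [Finset.HasAntidiagonal.mem_antidiagonal] at h
    rcases Nat.even_or_odd' a with ⟨i, rfl | rfl⟩
    · obtain ⟨j, rfl⟩ : ∃ j, b = 2 * j + 1 := ⟨m - i, by simp only at h; omega⟩
      simp [semicircleMoment_odd]
    · simp [semicircleMoment_odd]

lemma sum_sum_pow_mul_div_sub (U : Finset ℝ) (k : ℕ) :
    ∑ u ∈ U, u ^ k * ∑ v ∈ U.erase u, 2 / (u - v) =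
      ∑ u ∈ U, ∑ v ∈ U, (u ^ k - v ^ k) / (u - v) := by
  have h1 : ∀ u ∈ U, u ^ k * ∑ v ∈ U.erase u, 2 / (u - v) =
      ∑ v ∈ U, u ^ k / (u - v) + ∑ v ∈ U, u ^ k / (u - v) := by
    intro u hu
    rw [← Finset.add_sum_erase U _ hu, sub_self, div_zero, zero_add, Finset.mul_sum,
      ← Finset.sum_add_distrib]
    exact Finset.sum_congr rfl fun v _ => by ring
  rw [Finset.sum_congr rfl h1, Finset.sum_add_distrib]
  nth_rewrite 2 [Finset.sum_comm]
  rw [← Finset.sum_add_distrib]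
  refine Finset.sum_congr rfl fun u _ => ?_
  rw [← Finset.sum_add_distrib]
  refine Finset.sum_congr rfl fun v _ => ?_
  rw [← neg_sub u v, div_neg]
  ring

lemma sum_sum_pow_succ_mul_div_sub (U : Finset ℝ) (k : ℕ) :
    ∑ u ∈ U, u ^ (k + 1) * ∑ v ∈ U.erase u, 2 / (u - v) =
      ∑ p ∈ Finset.HasAntidiagonal.antidiagonal k, (∑ u ∈ U, u ^ p.1) * (∑ u ∈ U, u ^ p.2) -
        (k + 1) * ∑ u ∈ U, u ^ k := by
  rw [sum_sum_pow_mul_div_sub]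
  have h : ∀ u v : ℝ, (u ^ (k + 1) - v ^ (k + 1)) / (u - v) =
      ∑ p ∈ Finset.HasAntidiagonal.antidiagonal k, u ^ p.1 * v ^ p.2 -
        if u = v then (k + 1) * u ^ k else 0 := by
    intro u v
    rw [Finset.Nat.sum_antidiagonal_eq_sum_range_succ_mk]
    split_ifs with huv
    · subst huv
      have : ∀ i ∈ Finset.range k.succ, u ^ i * u ^ (k - i) = u ^ k := fun i hi => by
        rw [← pow_add, Nat.add_sub_cancel' (Nat.lt_succ_iff.mp (Finset.mem_range.mp hi))]
      simp only [sub_self, div_zero]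
      rw [Finset.sum_congr rfl this]
      simp
    · rw [sub_zero, div_eq_iff (sub_ne_zero.mpr huv), ← geom_sum₂_mul u v (k + 1)]
      simp
  simp only [h, Finset.sum_sub_distrib, Finset.sum_ite_eq]
  congr 1
  · simp only [Finset.sum_mul_sum]
    symm
    rw [Finset.sum_comm]
    exact Finset.sum_congr rfl fun u _ => Finset.sum_comm
  · rw [Finset.mul_sum]
    exact Finset.sum_congr rfl fun u hu => by simp [hu]

/-- If the finite sets `U n` are in equilibrium in an external field that becomes harmonic as
`n → ∞`, then the moments of their counting measures converge to those of a semicircle law. -/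
lemma tendsto_moment_of_equilibrium {U : ℕ → Finset ℝ} (hU : ∀ᶠ n in atTop, (U n).card = n)
    {A B C κ d : ℕ → ℝ} (hA : Tendsto A atTop (𝓝 4)) (hB : Tendsto B atTop (𝓝 0))
    (hC : Tendsto C atTop (𝓝 0)) (hκ : Tendsto κ atTop (𝓝 1)) (hd : Tendsto d atTop (𝓝 0))
    (heq : ∀ᶠ n in atTop, ∀ u ∈ U n, (A n + B n * u + C n * u ^ 2) *
      ((∑ v ∈ (U n).erase u, 2 / (u - v)) / n) = κ n * u + d n) (k : ℕ) :
    Tendsto (fun n => (∑ u ∈ U n, u ^ k) / n) atTop (𝓝 (semicircleMoment k)) := by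
  set M : ℕ → ℕ → ℝ := fun k n => (∑ u ∈ U n, u ^ k) / n with hM
  set E : ℕ → ℕ → ℝ := fun k n => (∑ u ∈ U n, u ^ k * ∑ v ∈ (U n).erase u, 2 / (u - v)) / n ^ 2
    with hE
  have hE0 : ∀ n, E 0 n = 0 := fun n => by
    simp only [hE, sum_sum_pow_mul_div_sub]
    simp
  have hES : ∀ k n, E (k + 1) n = ∑ p ∈ Finset.HasAntidiagonal.antidiagonal k,
      M p.1 n * M p.2 n - (k + 1) * M k n * (n : ℝ)⁻¹ := by
    intro k n
    simp only [hE, hM]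
    rw [sum_sum_pow_succ_mul_div_sub, sub_div, Finset.sum_div]
    congr 1
    · exact Finset.sum_congr rfl fun p _ => by ring
    · ring
  have hrec : ∀ k, ∀ᶠ n in atTop, A n * E k n + B n * E (k + 1) n + C n * E (k + 2) n =
      κ n * M (k + 1) n + d n * M k n := by
    intro k
    filter_upwards [heq, eventually_ge_atTop 1] with n hn hn1
    have hn0 : (n : ℝ) ≠ 0 := by positivity
    simp only [hE, hM, Finset.sum_div, Finset.mul_sum (s := U n), ← Finset.sum_add_distrib]
    refine Finset.sum_congr rfl fun u hu => ?_
    have := hn u hu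
    field_simp
    field_simp at this
    linear_combination u ^ k * this
  have hinv : Tendsto (fun n : ℕ => (n : ℝ)⁻¹) atTop (𝓝 0) := tendsto_inv_atTop_nhds_zero_nat
  have hM0 : ∀ᶠ n in atTop, M 0 n = 1 := by
    filter_upwards [eventually_ge_atTop 1, hU] with n hn hc
    have hn0 : (n : ℝ) ≠ 0 := by positivity
    simp [hM, hc, hn0]
  suffices h : ∀ j, Tendsto (M j) atTop (𝓝 (semicircleMoment j)) from h k
  intro j
  induction j using Nat.strong_induction_on with
  | _ j ih =>
  rcases j with _ | k
  · refine Tendsto.congr' (hM0.mono fun n hn => hn.symm) ?_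
    simp [semicircleMoment]
  have hsum : ∀ j ≤ k, Tendsto (fun n => ∑ p ∈ Finset.HasAntidiagonal.antidiagonal j,
      M p.1 n * M p.2 n) atTop (𝓝 (∑ p ∈ Finset.HasAntidiagonal.antidiagonal j,
        semicircleMoment p.1 * semicircleMoment p.2)) := by
    intro j hj
    refine tendsto_finsetSum _ fun p hp => ?_
    rw [Finset.HasAntidiagonal.mem_antidiagonal] at hp
    exact (ih _ (by omega)).mul (ih _ (by omega))
  have hElim : ∀ j ≤ k, Tendsto (E (j + 1)) atTop
      (𝓝 (∑ p ∈ Finset.HasAntidiagonal.antidiagonal j,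
        semicircleMoment p.1 * semicircleMoment p.2)) := by
    intro j hj
    have := (hsum j hj).sub (((ih j (by omega)).const_mul ((j : ℝ) + 1)).mul hinv)
    rw [mul_zero, sub_zero] at this
    exact this.congr fun n => (hES j n).symm
  have hEk : Tendsto (fun n => A n * E k n) atTop (𝓝 (semicircleMoment (k + 1))) := by
    rcases k with _ | k
    · simp only [hE0, mul_zero]
      simp [semicircleMoment]
    · rw [semicircleMoment_add_two]
      exact hA.mul (hElim k (by omega))
  obtain ⟨r, hr⟩ : ∃ r, Tendsto (fun n => ∑ p ∈ Finset.HasAntidiagonal.antidiagonal (k + 1),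
      M p.1 n * M p.2 n - 2 * M (k + 1) n) atTop (𝓝 r) := by
    rcases k with _ | k
    · refine ⟨0, tendsto_const_nhds.congr' ?_⟩
      filter_upwards [hM0] with n hn
      simp [Finset.Nat.antidiagonal_succ, hn]
      ring
    · refine ⟨∑ p ∈ Finset.HasAntidiagonal.antidiagonal k,
        semicircleMoment (p.1 + 1) * semicircleMoment (p.2 + 1),
        Tendsto.congr' ?_ (tendsto_finsetSum (f := fun p n => M (p.1 + 1) n * M (p.2 + 1) n) _
          fun p hp => ?_)⟩
      · filter_upwards [hM0] with n hn
        rw [Finset.Nat.sum_antidiagonal_succ, Finset.Nat.sum_antidiagonal_succ']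
        simp only [hn]
        ring
      · rw [Finset.HasAntidiagonal.mem_antidiagonal] at hp
        exact (ih _ (by omega)).mul (ih _ (by omega))
  have hden : Tendsto (fun n => κ n - C n * (2 - (k + 2) * (n : ℝ)⁻¹)) atTop (𝓝 1) := by
    simpa using hκ.sub (hC.mul ((hinv.const_mul ((k : ℝ) + 2)).const_sub 2))
  have hnum := ((hEk.add (hB.mul (hElim k le_rfl))).add (hC.mul hr)).sub
    (hd.mul (ih k (by omega)))
  have hlim := hnum.div hden one_ne_zero
  simp only [zero_mul, add_zero, sub_zero, div_one] at hlim
  refine hlim.congr' ?_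
  filter_upwards [hden.eventually_ne one_ne_zero, hrec k] with n hn h
  simp only [Pi.div_apply]
  rw [div_eq_iff hn]
  have h2 := hES (k + 1) n
  push_cast at h2
  linear_combination h - C n * h2

/-- The density of the semicircle law of radius `4`. -/
noncomputable def semicircleDensity (x : ℝ) : ℝ := √(16 - x ^ 2) / (8 * Real.pi)

lemma continuous_semicircleDensity : Continuous semicircleDensity := by
  unfold semicircleDensity
  fun_prop

lemma semicircleDensity_nonneg (x : ℝ) : 0 ≤ semicircleDensity x := by
  unfold semicircleDensity
  positivity

lemma semicircleDensity_le_one (x : ℝ) : semicircleDensity x ≤ 1 := by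
  unfold semicircleDensity
  have h1 : √(16 - x ^ 2) ≤ 4 := Real.sqrt_le_iff.mpr ⟨by norm_num, by nlinarith [sq_nonneg x]⟩
  rw [div_le_one (by positivity)]
  linarith [Real.pi_gt_three]

lemma semicircleDensity_eq_zero {x : ℝ} (hx : 4 ≤ |x|) : semicircleDensity x = 0 := by
  unfold semicircleDensity
  rw [Real.sqrt_eq_zero_of_nonpos, zero_div]
  rw [← sq_abs]
  nlinarith

lemma integral_mul_semicircleDensity {f : ℝ → ℝ} (hf : Continuous f) :
    ∫ x in (-5 : ℝ)..5, f x * semicircleDensity x =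
      ∫ x in (-4 : ℝ)..4, f x * semicircleDensity x := by
  have hi : ∀ a b : ℝ, IntervalIntegrable (fun x => f x * semicircleDensity x)
      MeasureTheory.volume a b :=
    fun a b => (hf.mul continuous_semicircleDensity).intervalIntegrable a b
  have h0 : ∀ a b : ℝ, (∀ x ∈ Set.uIcc a b, 4 ≤ |x|) →
      ∫ x in a..b, f x * semicircleDensity x = 0 := by
    intro a b h
    rw [intervalIntegral.integral_congr (g := fun _ => 0), intervalIntegral.integral_zero]
    intro x hx
    simp [semicircleDensity_eq_zero (h x hx)]
  rw [← intervalIntegral.integral_add_adjacent_intervals (hi (-5) (-4)) (hi (-4) 5),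
    ← intervalIntegral.integral_add_adjacent_intervals (hi (-4) 4) (hi 4 5), h0 (-5) (-4), h0 4 5]
  · ring
  · intro x hx
    rw [Set.uIcc_of_le (by norm_num)] at hx
    exact hx.1.trans (le_abs_self x)
  · intro x hx
    rw [Set.uIcc_of_le (by norm_num)] at hx
    exact (by linarith [hx.2] : 4 ≤ -x).trans (neg_le_abs x)

lemma integral_pow_mul_sqrt_succ (k : ℕ) :
    ((k : ℝ) + 4) * ∫ x in (-4 : ℝ)..4, x ^ (k + 2) * √(16 - x ^ 2) =
      16 * (k + 1) * ∫ x in (-4 : ℝ)..4, x ^ k * √(16 - x ^ 2) := by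
  have hc : ∀ j : ℕ, Continuous fun x : ℝ => x ^ j * √(16 - x ^ 2) := fun j => by fun_prop
  have h := intervalIntegral.integral_eq_sub_of_hasDerivAt_of_le (a := -4) (b := 4)
    (f := fun x : ℝ => x ^ (k + 1) * ((16 - x ^ 2) * √(16 - x ^ 2)))
    (f' := fun x => 16 * (k + 1) * (x ^ k * √(16 - x ^ 2)) -
      (k + 4) * (x ^ (k + 2) * √(16 - x ^ 2)))
    (by norm_num) (by fun_prop) ?_ ?_
  · rw [intervalIntegral.integral_sub (((hc k).const_mul _).intervalIntegrable _ _)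
      (((hc (k + 2)).const_mul _).intervalIntegrable _ _), intervalIntegral.integral_const_mul,
      intervalIntegral.integral_const_mul] at h
    norm_num at h
    linarith
  · intro x hx
    have hp : 0 < 16 - x ^ 2 := by nlinarith [hx.1, hx.2]
    have hs : 0 < √(16 - x ^ 2) := Real.sqrt_pos.mpr hp
    have d0 : HasDerivAt (fun x : ℝ => 16 - x ^ 2) (-(2 * x)) x := by
      simpa using (hasDerivAt_pow 2 x).const_sub 16
    refine ((hasDerivAt_pow (k + 1) x).mul (d0.mul (d0.sqrt hp.ne'))).congr_deriv ?_
    simp only [Pi.mul_apply]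
    push_cast
    field_simp
    rw [Real.sq_sqrt hp.le]
    simp
    ring
  · exact (((hc k).const_mul _).sub ((hc (k + 2)).const_mul _)).intervalIntegrable _ _

lemma integral_sqrt_sixteen_sub_sq : ∫ x in (-4 : ℝ)..4, √(16 - x ^ 2) = 8 * Real.pi := by
  have h := intervalIntegral.integral_comp_mul_left (a := -1) (b := 1)
    (fun x => √(16 - x ^ 2)) (show (4 : ℝ) ≠ 0 by norm_num)
  have h2 : ∀ x : ℝ, √(16 - (4 * x) ^ 2) = 4 * √(1 - x ^ 2) := by
    intro x
    rw [show 16 - (4 * x) ^ 2 = 4 ^ 2 * (1 - x ^ 2) by ring, Real.sqrt_mul (by norm_num),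
      Real.sqrt_sq (by norm_num)]
  simp only [h2, intervalIntegral.integral_const_mul, integral_sqrt_one_sub_sq] at h
  norm_num at h
  linarith

lemma integral_pow_mul_semicircleDensity (k : ℕ) :
    ∫ x in (-5 : ℝ)..5, x ^ k * semicircleDensity x = semicircleMoment k := by
  rw [integral_mul_semicircleDensity (continuous_pow k)]
  have h1 : ∀ k : ℕ, ∫ x in (-4 : ℝ)..4, x ^ k * semicircleDensity x =
      (∫ x in (-4 : ℝ)..4, x ^ k * √(16 - x ^ 2)) / (8 * Real.pi) := by
    intro k
    rw [← intervalIntegral.integral_div]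
    refine intervalIntegral.integral_congr fun x _ => ?_
    simp only [semicircleDensity]
    ring
  rcases Nat.even_or_odd' k with ⟨m, rfl | rfl⟩
  · rw [semicircleMoment_even, h1, div_eq_iff (by positivity)]
    induction m with
    | zero => simp [integral_sqrt_sixteen_sub_sq]
    | succ m ih =>
      have h := integral_pow_mul_sqrt_succ (2 * m)
      rw [ih] at h
      have hcat : ((m : ℝ) + 2) * catalan (m + 1) = 2 * (2 * m + 1) * catalan m := by
        have e1 := succ_mul_catalan_eq_centralBinom (m + 1)
        have e2 := succ_mul_catalan_eq_centralBinom m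
        have e3 := Nat.succ_mul_centralBinom_succ m
        rw [← e1, ← e2] at e3
        have e4 : ((m : ℝ) + 1) * ((m + 1 + 1) * catalan (m + 1)) =
            2 * (2 * m + 1) * ((m + 1) * catalan m) := by exact_mod_cast e3
        have : (m : ℝ) + 1 ≠ 0 := by positivity
        apply mul_left_cancel₀ this
        linear_combination e4
      rw [show 2 * (m + 1) = 2 * m + 2 by ring]
      have : ((2 * m : ℕ) : ℝ) + 4 ≠ 0 := by positivity
      apply mul_left_cancel₀ this
      rw [h]
      push_cast
      linear_combination (-64 * 4 ^ m * Real.pi) * hcat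
  · rw [semicircleMoment_odd]
    have h := intervalIntegral.integral_comp_neg (a := -4) (b := 4)
      (fun x => x ^ (2 * m + 1) * semicircleDensity x)
    have h2 : ∀ x : ℝ, (-x) ^ (2 * m + 1) * semicircleDensity (-x) =
        -(x ^ (2 * m + 1) * semicircleDensity x) := by
      intro x
      rw [Odd.neg_pow ⟨m, rfl⟩]
      simp [semicircleDensity]
    simp only [h2, intervalIntegral.integral_neg, neg_neg] at h
    linarith

lemma semicircleMoment_two_mul_le (m : ℕ) : semicircleMoment (2 * m) ≤ 16 ^ m := by
  have h : catalan m ≤ 4 ^ m := by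
    refine (Nat.le_mul_of_pos_left _ m.succ_pos).trans
      ((succ_mul_catalan_eq_centralBinom m).trans_le ?_)
    rw [Nat.centralBinom_eq_two_mul_choose]
    exact (Nat.choose_le_two_pow _ _).trans_eq (by rw [pow_mul]; norm_num)
  have h' : (catalan m : ℝ) ≤ 4 ^ m := by exact_mod_cast h
  rw [semicircleMoment_even, show (16 : ℝ) = 4 * 4 by norm_num, mul_pow]
  gcongr

lemma tendsto_sum_polynomial_div {U : ℕ → Finset ℝ}
    (hM : ∀ k, Tendsto (fun n => (∑ u ∈ U n, u ^ k) / n) atTop (𝓝 (semicircleMoment k)))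
    (p : Polynomial ℝ) :
    Tendsto (fun n => (∑ u ∈ U n, p.eval u) / n) atTop
      (𝓝 (∫ x in (-5 : ℝ)..5, p.eval x * semicircleDensity x)) := by
  induction p using Polynomial.induction_on' with
  | add p q hp hq =>
    have hi : ∀ p : Polynomial ℝ, IntervalIntegrable (fun x => p.eval x * semicircleDensity x)
        MeasureTheory.volume (-5) 5 := fun p =>
      (p.continuous.mul continuous_semicircleDensity).intervalIntegrable _ _
    simp only [Polynomial.eval_add, Finset.sum_add_distrib, add_div, add_mul]
    rw [intervalIntegral.integral_add (hi p) (hi q)]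
    exact hp.add hq
  | monomial k a =>
    simp only [Polynomial.eval_monomial, ← Finset.mul_sum, mul_assoc, mul_div_assoc,
      intervalIntegral.integral_const_mul, integral_pow_mul_semicircleDensity]
    exact (hM k).const_mul a

lemma exists_abs_eval_le_mul_pow (p : Polynomial ℝ) :
    ∃ K, 0 ≤ K ∧ ∃ d : ℕ, ∀ x : ℝ, 1 ≤ |x| → |p.eval x| ≤ K * (x ^ 2) ^ d := by
  refine ⟨∑ i ∈ Finset.range (p.natDegree + 1), |p.coeff i|,
    Finset.sum_nonneg fun _ _ => abs_nonneg _, p.natDegree, fun x hx => ?_⟩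
  rw [Polynomial.eval_eq_sum_range, Finset.sum_mul]
  refine (Finset.abs_sum_le_sum_abs _ _).trans (Finset.sum_le_sum fun i hi => ?_)
  rw [abs_mul, abs_pow, ← sq_abs, ← pow_mul]
  refine mul_le_mul_of_nonneg_left (pow_le_pow_right₀ hx ?_) (abs_nonneg _)
  have := Finset.mem_range.mp hi
  omega

/-- Convergence of moments to those of the semicircle law implies weak convergence. -/
lemma tendsto_sum_div_of_tendsto_moment {U : ℕ → Finset ℝ}
    (hU : ∀ᶠ n in atTop, (U n).card = n)
    (hM : ∀ k, Tendsto (fun n => (∑ u ∈ U n, u ^ k) / n) atTop (𝓝 (semicircleMoment k)))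
    {f : ℝ → ℝ} (hf : Continuous f) (hf1 : ∀ x, |f x| ≤ 1) :
    Tendsto (fun n => (∑ u ∈ U n, f u) / n) atTop
      (𝓝 (∫ x in (-5 : ℝ)..5, f x * semicircleDensity x)) := by
  rw [Metric.tendsto_nhds]
  intro ε' hε'
  obtain ⟨ε, hε, rfl⟩ : ∃ ε, 0 < ε ∧ ε' = 4 * ε := ⟨ε' / 4, by positivity, by ring⟩
  obtain ⟨p, hp⟩ := exists_polynomial_near_of_continuousOn (-5) 5 f hf.continuousOn ε hε
  obtain ⟨K, hK, d, hKd⟩ := exists_abs_eval_le_mul_pow p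
  set L := (K + 1) * 25 ^ d with hL
  have hL0 : 0 ≤ L := by positivity
  obtain ⟨m, hm, hmd⟩ : ∃ m : ℕ, L * (16 / 25) ^ m < ε ∧ d ≤ m := by
    have h1 : Tendsto (fun m : ℕ => L * (16 / 25 : ℝ) ^ m) atTop (𝓝 0) := by
      simpa using (tendsto_pow_atTop_nhds_zero_of_lt_one (by norm_num) (by norm_num)).const_mul L
    exact ((h1.eventually_lt_const hε).and (eventually_ge_atTop d)).exists
  have hbound : ∀ x, |f x - p.eval x| ≤ ε + L / 25 ^ m * x ^ (2 * m) := by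
    intro x
    rcases le_or_gt |x| 5 with hx | hx
    · have h1 := (hp x (abs_le.mp hx)).le
      rw [abs_sub_comm]
      have : 0 ≤ L / 25 ^ m * x ^ (2 * m) := by rw [pow_mul]; positivity
      linarith
    · have h25 : 25 ≤ x ^ 2 := by rw [← sq_abs]; nlinarith
      have h1 : (x ^ 2) ^ d ≤ 25 ^ d / 25 ^ m * x ^ (2 * m) := by
        have h2 : (x ^ 2 / 25) ^ d ≤ (x ^ 2 / 25) ^ m :=
          pow_le_pow_right₀ (by rw [one_le_div (by norm_num)]; exact h25) hmd
        rw [div_pow, div_pow, div_le_iff₀ (by positivity)] at h2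
        rw [pow_mul x]
        calc (x ^ 2) ^ d ≤ _ := h2
          _ = _ := by ring
      have h3 : 1 ≤ (x ^ 2) ^ d := one_le_pow₀ (by linarith)
      have h4 := hKd x (by linarith)
      have h5 : |f x - p.eval x| ≤ |f x| + |p.eval x| := abs_sub _ _
      calc |f x - p.eval x| ≤ (K + 1) * (x ^ 2) ^ d := by linarith [hf1 x]
        _ ≤ (K + 1) * (25 ^ d / 25 ^ m * x ^ (2 * m)) := by gcongr
        _ = L / 25 ^ m * x ^ (2 * m) := by rw [hL]; ring
        _ ≤ _ := by linarith
  have htail : ∀ᶠ n in atTop, L / 25 ^ m * ((∑ u ∈ U n, u ^ (2 * m)) / n) < ε := by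
    refine ((hM (2 * m)).const_mul (L / 25 ^ m)).eventually_lt_const (lt_of_le_of_lt ?_ hm)
    rw [div_pow]
    calc L / 25 ^ m * semicircleMoment (2 * m) ≤ L / 25 ^ m * 16 ^ m := by
          gcongr
          exact semicircleMoment_two_mul_le m
      _ = _ := by ring
  have hpf : |∫ x in (-5 : ℝ)..5, (p.eval x - f x) * semicircleDensity x| ≤ ε := by
    have h1 : ∫ x in (-5 : ℝ)..5, ε * semicircleDensity x = ε := by
      have := integral_pow_mul_semicircleDensity 0
      simp only [pow_zero, one_mul] at this
      rw [intervalIntegral.integral_const_mul, this]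
      simp [semicircleMoment]
    rw [← h1, ← Real.norm_eq_abs]
    have hi : IntervalIntegrable (fun x => ε * semicircleDensity x) MeasureTheory.volume (-5) 5 :=
      (continuous_semicircleDensity.const_mul ε).intervalIntegrable _ _
    refine intervalIntegral.norm_integral_le_of_norm_le (by norm_num)
      (Filter.Eventually.of_forall fun x hx => ?_) hi
    rw [Real.norm_eq_abs, abs_mul, abs_of_nonneg (semicircleDensity_nonneg x)]
    exact mul_le_mul_of_nonneg_right (hp x ⟨hx.1.le, hx.2⟩).le (semicircleDensity_nonneg x)
  have hi : ∀ g : ℝ → ℝ, Continuous g → IntervalIntegrable (fun x => g x * semicircleDensity x)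
      MeasureTheory.volume (-5) 5 := fun g hg =>
    (hg.mul continuous_semicircleDensity).intervalIntegrable _ _
  simp only [sub_mul] at hpf
  rw [intervalIntegral.integral_sub (hi _ p.continuous) (hi f hf)] at hpf
  filter_upwards [htail, hU, eventually_ge_atTop 1,
    (Metric.tendsto_nhds.mp (tendsto_sum_polynomial_div hM p)) ε hε] with n h1 h2 h3 h4
  have hn0 : (0 : ℝ) < n := by exact_mod_cast h3
  have h5 : |(∑ u ∈ U n, f u) / n - (∑ u ∈ U n, p.eval u) / n| ≤
      ε + L / 25 ^ m * ((∑ u ∈ U n, u ^ (2 * m)) / n) := by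
    rw [← sub_div, ← Finset.sum_sub_distrib, abs_div, abs_of_pos hn0, div_le_iff₀ hn0]
    calc |∑ u ∈ U n, (f u - p.eval u)| ≤ ∑ u ∈ U n, (ε + L / 25 ^ m * u ^ (2 * m)) :=
          (Finset.abs_sum_le_sum_abs _ _).trans (Finset.sum_le_sum fun u _ => hbound u)
      _ = _ := by
          rw [Finset.sum_add_distrib, Finset.sum_const, h2, ← Finset.mul_sum, nsmul_eq_mul]
          field_simp
  rw [Real.dist_eq, abs_lt] at *
  rw [abs_le] at h5 hpf
  constructor <;> linarith [h5.1, h5.2, hpf.1, hpf.2, h4.1, h4.2]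

/-- The continuous function that is `1` up to `s`, `0` from `s + δ` on, and affine between. -/
noncomputable def ramp (s δ x : ℝ) : ℝ := max 0 (min 1 ((s + δ - x) / δ))

lemma continuous_ramp (s δ : ℝ) : Continuous (ramp s δ) := by
  unfold ramp
  fun_prop

lemma ramp_nonneg (s δ x : ℝ) : 0 ≤ ramp s δ x := le_max_left _ _

lemma ramp_le_one (s δ x : ℝ) : ramp s δ x ≤ 1 := max_le zero_le_one (min_le_left _ _)

lemma ramp_eq_one {s δ x : ℝ} (hδ : 0 < δ) (hx : x ≤ s) : ramp s δ x = 1 := by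
  unfold ramp
  rw [min_eq_left, max_eq_right zero_le_one]
  rw [one_le_div hδ]
  linarith

lemma ramp_eq_zero {s δ x : ℝ} (hδ : 0 < δ) (hx : s + δ ≤ x) : ramp s δ x = 0 := by
  unfold ramp
  exact max_eq_left ((min_le_right _ _).trans (div_nonpos_of_nonpos_of_nonneg (by linarith) hδ.le))

lemma integral_ramp_mul_semicircleDensity {s δ : ℝ} (hδ : 0 < δ) (hs : -5 ≤ s) (hs' : s + δ ≤ 5) :
    ∫ x in (-5 : ℝ)..s, semicircleDensity x ≤
        ∫ x in (-5 : ℝ)..5, ramp s δ x * semicircleDensity x ∧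
      ∫ x in (-5 : ℝ)..5, ramp s δ x * semicircleDensity x ≤
        (∫ x in (-5 : ℝ)..s, semicircleDensity x) + δ := by
  have hi : ∀ a b : ℝ, IntervalIntegrable (fun x => ramp s δ x * semicircleDensity x)
      MeasureTheory.volume a b :=
    fun a b => ((continuous_ramp s δ).mul continuous_semicircleDensity).intervalIntegrable a b
  have h1 : ∫ x in (-5 : ℝ)..s, ramp s δ x * semicircleDensity x =
      ∫ x in (-5 : ℝ)..s, semicircleDensity x := by
    refine intervalIntegral.integral_congr fun x hx => ?_
    rw [Set.uIcc_of_le hs] at hx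
    simp [ramp_eq_one hδ hx.2]
  have h2 : ∫ x in (s + δ)..5, ramp s δ x * semicircleDensity x = 0 := by
    rw [intervalIntegral.integral_congr (g := fun _ => 0), intervalIntegral.integral_zero]
    intro x hx
    rw [Set.uIcc_of_le hs'] at hx
    simp [ramp_eq_zero hδ hx.1]
  have h3 : 0 ≤ ∫ x in s..(s + δ), ramp s δ x * semicircleDensity x :=
    intervalIntegral.integral_nonneg (by linarith) fun x _ =>
      mul_nonneg (ramp_nonneg _ _ _) (semicircleDensity_nonneg x)
  have h4 : ∫ x in s..(s + δ), ramp s δ x * semicircleDensity x ≤ δ := by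
    calc ∫ x in s..(s + δ), ramp s δ x * semicircleDensity x ≤ ∫ _ in s..(s + δ), (1 : ℝ) :=
          intervalIntegral.integral_mono_on (by linarith) (hi _ _)
            (continuous_const.intervalIntegrable _ _) fun x _ =>
              mul_le_one₀ (ramp_le_one _ _ _) (semicircleDensity_nonneg x)
                (semicircleDensity_le_one x)
      _ = δ := by simp
  rw [← intervalIntegral.integral_add_adjacent_intervals (hi (-5) s) (hi s 5),
    ← intervalIntegral.integral_add_adjacent_intervals (hi s (s + δ)) (hi (s + δ) 5), h1, h2]
  constructor <;> linarith

lemma tendsto_card_filter_le_div {U : ℕ → Finset ℝ} (hU : ∀ᶠ n in atTop, (U n).card = n)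
    (hM : ∀ k, Tendsto (fun n => (∑ u ∈ U n, u ^ k) / n) atTop (𝓝 (semicircleMoment k)))
    {t : ℝ} (ht : -4 ≤ t) (ht' : t ≤ 4) :
    Tendsto (fun n => (((U n).filter (· ≤ t)).card : ℝ) / n) atTop
      (𝓝 (∫ x in (-5 : ℝ)..t, semicircleDensity x)) := by
  rw [Metric.tendsto_nhds]
  intro ε hε
  obtain ⟨δ, hδ, hδ1, hδε⟩ : ∃ δ : ℝ, 0 < δ ∧ δ ≤ 1 ∧ δ < ε / 2 :=
    ⟨min 1 (ε / 4), by positivity, min_le_left _ _, (min_le_right _ _).trans_lt (by linarith)⟩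
  have hlim := fun s => tendsto_sum_div_of_tendsto_moment hU hM (continuous_ramp s δ)
    fun x => abs_le.mpr ⟨by linarith [ramp_nonneg s δ x], ramp_le_one s δ x⟩
  have hup := (integral_ramp_mul_semicircleDensity hδ (s := t) (by linarith) (by linarith)).2
  have hlow :=
    (integral_ramp_mul_semicircleDensity hδ (s := t - δ) (by linarith) (by linarith)).1
  have hstep : ∫ x in (t - δ)..t, semicircleDensity x ≤ δ := by
    calc ∫ x in (t - δ)..t, semicircleDensity x ≤ ∫ _ in (t - δ)..t, (1 : ℝ) :=
          intervalIntegral.integral_mono_on (by linarith)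
            (continuous_semicircleDensity.intervalIntegrable _ _)
            (continuous_const.intervalIntegrable _ _) fun x _ => semicircleDensity_le_one x
      _ = δ := by simp
  have hadd := intervalIntegral.integral_add_adjacent_intervals
    (continuous_semicircleDensity.intervalIntegrable (μ := MeasureTheory.volume) (-5) (t - δ))
    (continuous_semicircleDensity.intervalIntegrable (t - δ) t)
  filter_upwards [Metric.tendsto_nhds.mp (hlim t) (ε / 2) (by linarith),
    Metric.tendsto_nhds.mp (hlim (t - δ)) (ε / 2) (by linarith)] with n h1 h2
  have e : (((U n).filter (· ≤ t)).card : ℝ) = ∑ u ∈ U n, if u ≤ t then 1 else 0 := by simp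
  have h3 : (((U n).filter (· ≤ t)).card : ℝ) / n ≤ (∑ u ∈ U n, ramp t δ u) / n := by
    rw [e]
    gcongr with u _
    split_ifs with h
    · rw [ramp_eq_one hδ h]
    · exact ramp_nonneg _ _ _
  have h4 : (∑ u ∈ U n, ramp (t - δ) δ u) / n ≤ (((U n).filter (· ≤ t)).card : ℝ) / n := by
    rw [e]
    gcongr with u _
    split_ifs with h
    · exact ramp_le_one _ _ _
    · rw [ramp_eq_zero hδ (by linarith)]
  rw [Real.dist_eq, abs_lt] at *
  constructor <;> linarith [h1.1, h1.2, h2.1, h2.2]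

lemma integral_semicircleDensity (ξ : ℝ) :
    ∫ x in (-5 : ℝ)..(ξ - 2), semicircleDensity x =
      1 / (8 * Real.pi) * ∫ x in (-2 : ℝ)..ξ, Real.sqrt ((6 - x) * (x + 2)) := by
  have h1 : ∫ x in (-5 : ℝ)..(-4), semicircleDensity x = 0 := by
    rw [intervalIntegral.integral_congr (g := fun _ => 0), intervalIntegral.integral_zero]
    intro x hx
    rw [Set.uIcc_of_le (by norm_num)] at hx
    exact semicircleDensity_eq_zero ((by linarith [hx.2] : 4 ≤ -x).trans (neg_le_abs x))
  rw [← intervalIntegral.integral_add_adjacent_intervals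
    (continuous_semicircleDensity.intervalIntegrable (-5) (-4))
    (continuous_semicircleDensity.intervalIntegrable (-4) (ξ - 2)), h1, zero_add,
    show (-4 : ℝ) = -2 - 2 by norm_num,
    ← intervalIntegral.integral_comp_sub_right (fun x => semicircleDensity x) 2,
    ← intervalIntegral.integral_const_mul]
  refine intervalIntegral.integral_congr fun x _ => ?_
  simp only [semicircleDensity]
  rw [show 16 - (x - 2) ^ 2 = (6 - x) * (x + 2) by ring]
  ring

lemma sum_inv_sub_image {S : Finset ℝ} {s c : ℝ} (hs : s ≠ 0) (x : ℝ) :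
    ∑ v ∈ (S.image fun y => (y - c) / s).erase ((x - c) / s), 2 / ((x - c) / s - v) =
      s * ∑ y ∈ S.erase x, 2 / (x - y) := by
  have hinj : Function.Injective fun y : ℝ => (y - c) / s := fun y z h => by
    simpa [div_left_inj' hs] using h
  rw [Finset.sum_erase _ (by simp), Finset.sum_image hinj.injOn,
    Finset.sum_erase _ (by simp), Finset.mul_sum]
  refine Finset.sum_congr rfl fun y _ => ?_
  rw [← sub_div, sub_sub_sub_cancel_right, div_div_eq_mul_div]
  ring

/-- The equilibrium relations, rescaled by `x = s * u + c`. -/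
lemma equilibrium_rescaled {n : ℕ} {α β s c x X : ℝ} (hn : (n : ℝ) ≠ 0) (hα : α ≠ 0) (hs : s ≠ 0)
    (h : (1 - x ^ 2) * X = (α + 1) * (1 + x) - (β + 1) * (1 - x)) :
    (n * (1 - c ^ 2) / (α * s ^ 2) + -2 * c * n / (α * s) * ((x - c) / s) +
      -n / α * ((x - c) / s) ^ 2) * (s * X / n) =
      (α + β + 2) / α * ((x - c) / s) + ((α + β + 2) * c + α - β) / (α * s) := by
  have h1 : (n * (1 - c ^ 2) / (α * s ^ 2) + -2 * c * n / (α * s) * ((x - c) / s) +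
      -n / α * ((x - c) / s) ^ 2) * (s * X / n) = (1 - x ^ 2) * X / (α * s) := by
    field_simp
    ring
  rw [h1, h]
  field_simp
  ring

lemma coefficients_eq {t p q : ℝ} (ht : t ≠ 0) (hp : p ≠ 0) (hq : q ≠ 0)
    {n α β r : ℝ} (hn : n = t / p) (hβ : β = 1 / (t * p)) (hα : α = 1 / (t * p * q))
    (hr : r = 1 / p) {D : ℝ} (hD : D ≠ 0) (hDq : D = 1 + q + 2 * t ^ 2 * q) {s c : ℝ}
    (hs : s = r / α) (hc : c = -((α + 2 * r - β) / (2 * n + α + β)) + 2 * s) {W : ℝ}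
    (hW : W = (t ^ 2 + 1 - t) / D + t) :
    n * (1 - c ^ 2) / (α * s ^ 2) = 2 * W * (2 - 2 * q * W) ∧
    -2 * c * n / (α * s) = -2 * (2 * q * W - 1) * t ∧
    -n / α = -(t ^ 2 * q) ∧
    (α + β + 2) / α = 1 + q + 2 * (t * q * p) ∧
    ((α + β + 2) * c + α - β) / (α * s) =
      2 * ((1 + q) * t - (1 + q) - 2 * t * q + (1 + q) * D) / D + 2 * p * (2 * q * W - 1) := by
  have hs' : s = t * q := by
    rw [hs, hr, hα]
    field_simp
  have hden : 2 * n + α + β = D / (t * p * q) := by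
    rw [hn, hα, hβ, hDq]
    field_simp
    ring
  have hc' : c = 2 * q * W - 1 := by
    rw [hc, hden, hs', hα, hβ, hr, hW]
    field_simp
    linear_combination hDq
  refine ⟨?_, ?_, ?_, ?_, ?_⟩
  · rw [hc', hs', hn, hα]
    field_simp
    ring
  · rw [hc', hs', hn, hα]
    field_simp
  · rw [hn, hα]
    field_simp
  · rw [hβ, hα]
    field_simp
  · have h1 : α * s = 1 / p := by
      rw [hα, hs']
      field_simp
    rw [h1, hc', hβ, hα, hW]
    field_simp
    rw [hDq]
    ring

lemma jacobiN_eq_card {n : ℕ} {α β s c ξ : ℝ} (hs : 0 < s) {S : Finset ℝ}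
    (hS : ∀ x, x ∈ S ↔ (jacobiPoly n (n + α) (n + β)).eval x = 0) :
    jacobiN n α β (s * ξ - c) =
      ((S.image fun x => (x - (-c + 2 * s)) / s).filter (· ≤ ξ - 2)).card := by
  have hinj : Function.Injective fun y : ℝ => (y - (-c + 2 * s)) / s := fun y z h => by
    simpa [div_left_inj' hs.ne'] using h
  rw [Finset.filter_image, Finset.card_image_of_injective _ hinj, jacobiN,
    ← Set.ncard_coe_finset]
  congr 1
  ext x
  simp only [Set.mem_ofPred_eq, Finset.coe_filter, hS, eval_jacobiPoly, div_le_iff₀ hs]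
  refine and_congr_right fun _ => ?_
  constructor <;> intro h <;> linarith

theorem stmt5 (α β : ℕ → ℝ)
    (hα : ∀ n, α n > -1) (hβ : ∀ n, β n > -1)
    (hαlim : Tendsto (fun n : ℕ => α n / n) atTop atTop)
    (hβlim : Tendsto (fun n : ℕ => β n / n) atTop atTop)
    (hq : Tendsto (fun n : ℕ => α n / β n) atTop atTop)
    (ξ : ℝ) (hξ1 : -2 ≤ ξ) (hξ2 : ξ ≤ 6) :
    Tendsto (fun n : ℕ =>
        (jacobiN n (α n) (β n)
          (Real.sqrt ((n : ℝ) * β n) / α n * ξ -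
            (α n + 2 * Real.sqrt ((n : ℝ) * β n) - β n) / (2 * (n : ℝ) + α n + β n)) : ℝ) / n)
      atTop (𝓝 (1 / (8 * Real.pi) *
        ∫ x in (-2 : ℝ)..ξ, Real.sqrt ((6 - x) * (x + 2)))) := by
  choose S hcard hmem hroots hsplits using fun n : ℕ =>
    exists_finset_zeros_jacobiPoly (n + α n) (n + β n) n (by linarith [hα n]) (by linarith [hβ n])
  have hne : ∀ n, jacobiPoly n (n + α n) (n + β n) ≠ 0 := fun n =>
    jacobiPoly_ne_zero (by linarith [hα n])
  set r : ℕ → ℝ := fun n => √(n * β n) with hr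
  set s : ℕ → ℝ := fun n => r n / α n with hs
  set c : ℕ → ℝ := fun n => (α n + 2 * r n - β n) / (2 * n + α n + β n) with hc
  set U : ℕ → Finset ℝ := fun n => (S n).image fun x => (x - (-c n + 2 * s n)) / s n with hUdef
  set t : ℕ → ℝ := fun n => √(n / β n) with ht
  set q : ℕ → ℝ := fun n => β n / α n with hqd
  set p : ℕ → ℝ := fun n => (r n)⁻¹ with hp
  have hn0 : ∀ᶠ n : ℕ in atTop, (0 : ℝ) < n := by
    filter_upwards [eventually_ge_atTop 1] with n hn
    exact_mod_cast hn
  have hα0 : ∀ᶠ n in atTop, 0 < α n := by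
    filter_upwards [hαlim.eventually_gt_atTop 0, hn0] with n h1 h2
    exact (div_pos_iff_of_pos_right h2).mp h1
  have hβ0 : ∀ᶠ n in atTop, 0 < β n := by
    filter_upwards [hβlim.eventually_gt_atTop 0, hn0] with n h1 h2
    exact (div_pos_iff_of_pos_right h2).mp h1
  have htlim : Tendsto t atTop (𝓝 0) := by
    have h1 := (hβlim.inv_tendsto_atTop).sqrt
    rw [Real.sqrt_zero] at h1
    refine h1.congr fun n => ?_
    simp [ht]
  have hqlim : Tendsto q atTop (𝓝 0) := hq.inv_tendsto_atTop.congr fun n => by simp [hqd]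
  have hplim : Tendsto p atTop (𝓝 0) := by
    have h1 : Tendsto (fun n : ℕ => (n : ℝ) * β n) atTop atTop := by
      refine ((tendsto_natCast_atTop_atTop (R := ℝ)).atTop_mul_atTop₀
        ((tendsto_natCast_atTop_atTop (R := ℝ)).atTop_mul_atTop₀ hβlim)).congr' ?_
      filter_upwards [hn0] with n hn
      field_simp
    exact (Real.tendsto_sqrt_atTop.comp h1).inv_tendsto_atTop
  have hDlim : Tendsto (fun n => 1 + q n + 2 * t n ^ 2 * q n) atTop (𝓝 1) := by
    simpa using (hqlim.const_add 1).add (((htlim.pow 2).const_mul 2).mul hqlim)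
  set W : ℕ → ℝ := fun n => (t n ^ 2 + 1 - t n) / (1 + q n + 2 * t n ^ 2 * q n) + t n with hW
  have hWlim : Tendsto W atTop (𝓝 1) := by
    simpa using ((((htlim.pow 2).add_const 1).sub htlim).div hDlim one_ne_zero).add htlim
  have hcoef : ∀ᶠ n : ℕ in atTop,
      n * (1 - (-c n + 2 * s n) ^ 2) / (α n * s n ^ 2) = 2 * W n * (2 - 2 * q n * W n) ∧
      -2 * (-c n + 2 * s n) * n / (α n * s n) = -2 * (2 * q n * W n - 1) * t n ∧
      -n / α n = -(t n ^ 2 * q n) ∧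
      (α n + β n + 2) / α n = 1 + q n + 2 * (t n * q n * p n) ∧
      ((α n + β n + 2) * (-c n + 2 * s n) + α n - β n) / (α n * s n) =
        2 * ((1 + q n) * t n - (1 + q n) - 2 * t n * q n +
          (1 + q n) * (1 + q n + 2 * t n ^ 2 * q n)) / (1 + q n + 2 * t n ^ 2 * q n) +
          2 * p n * (2 * q n * W n - 1) := by
    filter_upwards [hn0, hα0, hβ0, hDlim.eventually_ne one_ne_zero] with n h1 h2 h3 h4
    have ht0 : 0 < t n := Real.sqrt_pos.mpr (by positivity)
    have hr0 : 0 < r n := Real.sqrt_pos.mpr (by positivity)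
    have hq0 : 0 < q n := by positivity
    have hp0 : 0 < p n := by positivity
    have htr : t n * r n = n := by
      simp only [ht, hr]
      rw [← Real.sqrt_mul (by positivity), show (n : ℝ) / β n * (n * β n) = n ^ 2 by field_simp,
        Real.sqrt_sq h1.le]
    have hrβ : r n = t n * β n := by
      simp only [ht, hr]
      nth_rewrite 3 [← Real.sqrt_sq h3.le]
      rw [← Real.sqrt_mul (by positivity)]
      congr 1
      field_simp
    have hβ' : β n = 1 / (t n * p n) := by
      simp only [hp]
      rw [hrβ]
      field_simp
    exact coefficients_eq (W := W n) (n := n) (α := α n) (β := β n) (r := r n) (s := s n)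
      (c := -c n + 2 * s n) ht0.ne' hp0.ne' hq0.ne' (by simp [hp, htr]) hβ'
      (by rw [← div_div, ← hβ']; simp only [hqd]; field_simp) (by simp [hp]) h4 rfl rfl rfl rfl
  have hUcard : ∀ᶠ n in atTop, (U n).card = n := by
    filter_upwards [hn0, hα0, hβ0] with n h1 h2 h3
    have hs0 : s n ≠ 0 := (div_pos (Real.sqrt_pos.mpr (by positivity)) h2).ne'
    rw [hUdef, Finset.card_image_of_injective _ fun y z h => by
      simpa [div_left_inj' hs0] using h, hcard]
  have hmom := tendsto_moment_of_equilibrium hUcard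
    (A := fun n => n * (1 - (-c n + 2 * s n) ^ 2) / (α n * s n ^ 2))
    (B := fun n => -2 * (-c n + 2 * s n) * n / (α n * s n))
    (C := fun n => -n / α n)
    (κ := fun n => (α n + β n + 2) / α n)
    (d := fun n => ((α n + β n + 2) * (-c n + 2 * s n) + α n - β n) / (α n * s n))
    ?_ ?_ ?_ ?_ ?_ ?_
  · have hfin := tendsto_card_filter_le_div hUcard hmom (t := ξ - 2) (by linarith) (by linarith)
    rw [integral_semicircleDensity] at hfin
    refine hfin.congr' ?_
    filter_upwards [hn0, hα0, hβ0] with n h1 h2 h3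
    have hs0 : 0 < s n := div_pos (Real.sqrt_pos.mpr (by positivity)) h2
    rw [jacobiN_eq_card hs0 (hmem n)]
  · refine Tendsto.congr' (hcoef.mono fun n h => h.1.symm) ?_
    have := (hWlim.const_mul 2).mul (((hqlim.const_mul 2).mul hWlim).const_sub 2)
    norm_num at this
    exact this
  · refine Tendsto.congr' (hcoef.mono fun n h => h.2.1.symm) ?_
    simpa using ((((hqlim.const_mul 2).mul hWlim).sub_const 1).const_mul (-2)).mul htlim
  · refine Tendsto.congr' (hcoef.mono fun n h => h.2.2.1.symm) ?_
    simpa using ((htlim.pow 2).mul hqlim).neg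
  · refine Tendsto.congr' (hcoef.mono fun n h => h.2.2.2.1.symm) ?_
    simpa using (hqlim.const_add 1).add (((htlim.mul hqlim).mul hplim).const_mul 2)
  · refine Tendsto.congr' (hcoef.mono fun n h => h.2.2.2.2.symm) ?_
    have h1 := hqlim.const_add 1
    simpa using (((((h1.mul htlim).sub h1).sub ((htlim.const_mul 2).mul hqlim)).add
      (h1.mul hDlim)).const_mul 2 |>.div hDlim one_ne_zero).add
      ((hplim.const_mul 2).mul (((hqlim.const_mul 2).mul hWlim).sub_const 1))
  · filter_upwards [hn0, hα0, hβ0] with n h1 h2 h3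
    have hs0 : s n ≠ 0 := (div_pos (Real.sqrt_pos.mpr (by positivity)) h2).ne'
    intro u hu
    obtain ⟨x, hx, rfl⟩ := Finset.mem_image.mp hu
    simp only [hUdef]
    rw [sum_inv_sub_image hs0]
    refine equilibrium_rescaled h1.ne' h2.ne' hs0 ?_
    rw [sum_inv_sub_zeros_jacobiPoly (hroots n) (hsplits n) (hne n) hx]
    ring
end
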